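/- arXiv:2303.14316 — 2 statements merged into one kernel-verified Lean document; each statement's English description precedes it below -/
import Mathlib

section
/- Let B ⊆ ℕ be a set for which there exists a constant c > 0 such that #{n ∈ [M, 2M) : n ∈ B} ≥ c·M/(log log M)² for all sufficiently large M, and fix h < 1. Then the series Σ_{n ∈ B, n ≥ 3} φ(n) / (n² (log n)^h) diverges, where φ is Euler's totient function. -/
open Real Filter Finset

lemma half_le_prod_range_one_sub_inv_sq (N : ℕ) :
    (1 / 2 : ℝ) ≤ ∏ i ∈ range N, (1 - (((i + 2 : ℕ) : ℝ) ^ 2)⁻¹) := by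
  have key : ∏ i ∈ range N, (1 - (((i + 2 : ℕ) : ℝ) ^ 2)⁻¹) = (N + 2) / (2 * (N + 1)) := by
    induction N with
    | zero => norm_num
    | succ n ih =>
      rw [prod_range_succ, ih]
      push_cast
      field_simp
      ring
  rw [key, div_le_div_iff₀ (by positivity) (by positivity)]
  linarith

lemma half_le_prod_one_sub_inv_sq (S : Finset ℕ) (hS : ∀ p ∈ S, 2 ≤ p) :
    (1 / 2 : ℝ) ≤ ∏ p ∈ S, (1 - ((p : ℝ) ^ 2)⁻¹) := by
  have hle : ∀ i : ℕ, (((i + 2 : ℕ) : ℝ) ^ 2)⁻¹ ≤ 1 := fun i ↦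
    inv_le_one_of_one_le₀ (one_le_pow₀ (by push_cast; linarith [(Nat.cast_nonneg i : (0 : ℝ) ≤ i)]))
  have himage : S = (S.image (· - 2)).image (· + 2) := by
    ext p
    simp only [mem_image, exists_exists_and_eq_and]
    constructor
    · intro hp
      exact ⟨p, hp, Nat.sub_add_cancel (hS p hp)⟩
    · rintro ⟨q, hq, rfl⟩
      rwa [Nat.sub_add_cancel (hS q hq)]
  rw [himage, prod_image (by intro a _ b _ hab; simpa using hab)]
  refine (half_le_prod_range_one_sub_inv_sq ((S.image (· - 2)).sup id + 1)).trans ?_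
  refine prod_le_prod_of_subset_of_le_one ?_ ?_ ?_
  · intro i hi
    exact mem_range.2 (Nat.lt_succ_of_le (le_sup (f := id) hi))
  · intro i _
    exact sub_nonneg.2 (hle i)
  · intro i _ _
    exact sub_le_self _ (by positivity)

/-- The arithmetic function `n ↦ 1 / n`. -/
noncomputable def invArith : ArithmeticFunction ℝ := ⟨fun n ↦ (n : ℝ)⁻¹, by simp⟩

@[simp] lemma invArith_apply (n : ℕ) : invArith n = (n : ℝ)⁻¹ := rfl

lemma isMultiplicative_invArith : invArith.IsMultiplicative :=
  ⟨by simp, by intro m n _; simp [mul_comm]⟩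

lemma half_le_totient_div_mul_sum_divisors_inv {n : ℕ} (hn : n ≠ 0) :
    (1 / 2 : ℝ) ≤ (n.totient / n) * ∑ d ∈ n.divisors, (d : ℝ)⁻¹ := by
  have htot : (n.totient : ℝ) / n = ∏ p ∈ n.primeFactors, (1 - (p : ℝ)⁻¹) := by
    have h := congrArg (fun q : ℚ ↦ (q : ℝ)) (Nat.totient_eq_mul_prod_factors n)
    push_cast at h
    rw [h, mul_div_cancel_left₀ _ (Nat.cast_ne_zero.2 hn)]
  have hdiv : ∏ p ∈ n.primeFactors, (1 + (p : ℝ)⁻¹) ≤ ∑ d ∈ n.divisors, (d : ℝ)⁻¹ := by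
    have h := isMultiplicative_invArith.prodPrimeFactors_one_add_of_squarefree
      (n := ∏ p ∈ n.primeFactors, p) (Nat.radical_eq_prod_primeFactors ▸
        UniqueFactorizationMonoid.squarefree_radical)
    rw [Nat.primeFactors_prod fun p hp ↦ Nat.prime_of_mem_primeFactors hp] at h
    simp only [invArith_apply] at h
    rw [h]
    exact sum_le_sum_of_subset_of_nonneg
      (Nat.divisors_subset_of_dvd hn (Nat.prod_primeFactors_dvd n)) fun _ _ _ ↦ by positivity
  rw [htot]
  calc (1 / 2 : ℝ) ≤ ∏ p ∈ n.primeFactors, (1 - ((p : ℝ) ^ 2)⁻¹) :=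
        half_le_prod_one_sub_inv_sq _ fun p hp ↦ (Nat.prime_of_mem_primeFactors hp).two_le
    _ = (∏ p ∈ n.primeFactors, (1 - (p : ℝ)⁻¹)) * ∏ p ∈ n.primeFactors, (1 + (p : ℝ)⁻¹) := by
        rw [← prod_mul_distrib]
        exact prod_congr rfl fun p _ ↦ by ring
    _ ≤ _ := by
        refine mul_le_mul_of_nonneg_left hdiv ?_
        rw [← htot]
        positivity

lemma sum_sum_divisors_inv_le (N : ℕ) :
    ∑ n ∈ Ioc 0 N, ∑ d ∈ n.divisors, (d : ℝ)⁻¹ ≤ 2 * N := by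
  have h := ArithmeticFunction.sum_Ioc_mul_zeta_eq_sum invArith N
  simp only [ArithmeticFunction.coe_mul_zeta_apply, invArith_apply] at h
  rw [h]
  calc ∑ n ∈ Ioc 0 N, (n : ℝ)⁻¹ * ((N / n : ℕ) : ℝ)
      ≤ ∑ n ∈ Ioc 0 N, ((n : ℝ) ^ 2)⁻¹ * N := by
        refine sum_le_sum fun n _ ↦ ?_
        calc (n : ℝ)⁻¹ * ((N / n : ℕ) : ℝ) ≤ (n : ℝ)⁻¹ * (N / n) := by
              gcongr
              exact Nat.cast_div_le
          _ = _ := by ring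
    _ = (∑ n ∈ Ioo 0 (N + 1), ((n : ℝ) ^ 2)⁻¹) * N := by
        rw [sum_mul]
        refine sum_congr ?_ fun _ _ ↦ rfl
        ext i
        simp only [mem_Ioc, mem_Ioo]
        omega
    _ ≤ 2 * N := by
        gcongr
        simpa using sum_Ioo_inv_sq_le (α := ℝ) 0 (N + 1)

lemma card_sq_le_mul_sum_totient_div_sq {M : ℕ} (hM : 0 < M) (s : Finset ℕ)
    (hs : s ⊆ Ico M (2 * M)) :
    (#s : ℝ) ^ 2 ≤ 16 * M ^ 2 * ∑ n ∈ s, (n.totient : ℝ) / n ^ 2 := by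
  have hmem : ∀ n ∈ s, 0 < n ∧ n < 2 * M := fun n hn ↦ by
    have := mem_Ico.1 (hs hn)
    omega
  have hcs := sum_sq_le_sum_mul_sum_of_sq_le_mul s (r := fun _ ↦ (1 : ℝ))
    (f := fun n ↦ 2 * ((n.totient : ℝ) / n)) (g := fun n ↦ ∑ d ∈ n.divisors, (d : ℝ)⁻¹)
    (fun _ _ ↦ by positivity) (fun _ _ ↦ by positivity)
    (fun n hn ↦ by
      have := half_le_totient_div_mul_sum_divisors_inv (hmem n hn).1.ne'
      rw [mul_assoc]
      linarith)
  simp only [sum_const, nsmul_eq_mul, mul_one] at hcs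
  have hsum : ∑ n ∈ s, ∑ d ∈ n.divisors, (d : ℝ)⁻¹ ≤ 4 * M := by
    have h := sum_sum_divisors_inv_le (2 * M)
    push_cast at h
    refine (sum_le_sum_of_subset_of_nonneg (fun n hn ↦ ?_) fun _ _ _ ↦ by positivity).trans
      (h.trans (by linarith))
    have := hmem n hn
    exact mem_Ioc.2 ⟨this.1, this.2.le⟩
  have htot : ∑ n ∈ s, 2 * ((n.totient : ℝ) / n) ≤ 4 * M * ∑ n ∈ s, (n.totient : ℝ) / n ^ 2 := by
    rw [mul_sum]
    refine sum_le_sum fun n hn ↦ ?_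
    have h0 : (0 : ℝ) < n := by exact_mod_cast (hmem n hn).1
    have h1 : (n : ℝ) ≤ 2 * M := by exact_mod_cast (hmem n hn).2.le
    calc 2 * ((n.totient : ℝ) / n) = 2 * n * (n.totient / n ^ 2) := by field_simp
      _ ≤ 4 * M * (n.totient / n ^ 2) :=
        mul_le_mul_of_nonneg_right (by linarith) (by positivity)
  calc (#s : ℝ) ^ 2 ≤ _ := hcs
    _ ≤ (4 * M * ∑ n ∈ s, (n.totient : ℝ) / n ^ 2) * (4 * M) := by gcongr
    _ = _ := by ring

lemma eventually_log_pow_four_mul_rpow_le {t : ℝ} (ht : t < 1) :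
    ∀ᶠ x : ℝ in atTop, log x ^ 4 * x ^ t ≤ x := by
  have h := (isLittleO_log_rpow_rpow_atTop 4 (sub_pos.2 ht)).bound one_pos
  filter_upwards [h, eventually_ge_atTop 1] with x hx hx1
  have hlog := log_nonneg hx1
  have hx0 : 0 < x := by linarith
  rw [norm_of_nonneg (by positivity), norm_of_nonneg (by positivity), one_mul] at hx
  have hx' : log x ^ 4 ≤ x ^ (1 - t) := by exact_mod_cast hx
  calc log x ^ 4 * x ^ t ≤ x ^ (1 - t) * x ^ t := by gcongr
    _ = x := by rw [← rpow_add hx0]; simp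

lemma summable_sum_Ico_two_pow {f : ℕ → ℝ} (hf : ∀ n, 0 ≤ f n) (hsum : Summable f) :
    Summable fun k : ℕ ↦ ∑ n ∈ Ico (2 ^ k) (2 * 2 ^ k), f n := by
  refine summable_of_sum_range_le (c := ∑' n, f n) (fun k ↦ sum_nonneg fun n _ ↦ hf n) fun K ↦ ?_
  refine le_trans ?_ (hsum.sum_le_tsum (range (2 ^ K)) fun n _ ↦ hf n)
  induction K with
  | zero => simpa using hf 0
  | succ K ih =>
    rw [sum_range_succ, pow_succ', ← sum_range_add_sum_Ico f (m := 2 ^ K) (by omega)]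
    gcongr

/-- If `B ⊆ ℕ` satisfies `#{n ∈ [M,2M) : n ∈ B} ≥ c·M/(log log M)²` for some `c > 0`
and all sufficiently large `M`, then for any fixed `h < 1` the series
`Σ_{n ∈ B, n ≥ 3} φ(n)/(n² (log n)^h)` diverges. -/
theorem divergence_of_totient_series (B : Set ℕ) (c : ℝ) (hc : 0 < c)
    (hB : ∀ᶠ M : ℕ in atTop,
      c * M / (Real.log (Real.log M)) ^ 2 ≤ ((Set.Ico M (2 * M)) ∩ B).ncard)
    (h : ℝ) (hh : h < 1) :
    ¬ Summable (Set.indicator {n : ℕ | n ∈ B ∧ 3 ≤ n}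
      (fun n : ℕ => (Nat.totient n : ℝ) / ((n : ℝ) ^ 2 * Real.log n ^ h))) := by
  classical
  intro hsum
  set F : ℕ → ℝ := fun n ↦ (Nat.totient n : ℝ) / ((n : ℝ) ^ 2 * Real.log n ^ h) with hF
  set t := max h 0
  have ht1 : t < 1 := max_lt hh one_pos
  have hF0 : ∀ n, 0 ≤ F n := fun n ↦ by
    have := rpow_nonneg (log_natCast_nonneg n) h
    positivity
  have hblocks := summable_sum_Ico_two_pow (Set.indicator_nonneg fun n _ ↦ hF0 n) hsum
  have hcast : Tendsto (fun k : ℕ ↦ (k : ℝ) + 1) atTop atTop :=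
    tendsto_atTop_add_const_right _ _ tendsto_natCast_atTop_atTop
  have hpow : Tendsto (fun k : ℕ ↦ 2 ^ k) atTop atTop :=
    tendsto_pow_atTop_atTop_of_one_lt (r := (2 : ℕ)) one_lt_two
  refine mt (fun hs ↦ (summable_nat_add_iff 1).1 hs) Real.not_summable_one_div_natCast ?_
  refine Summable.of_norm_bounded_eventually_nat (hblocks.mul_left (16 / c ^ 2)) ?_
  filter_upwards [hpow.eventually hB, hcast.eventually (eventually_log_pow_four_mul_rpow_le ht1),
    eventually_ge_atTop 4] with k hk hgrowth hk4
  set M : ℕ := 2 ^ k with hMdef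
  set s := (Ico M (2 * M)).filter (· ∈ B)
  have hM4 : 4 ≤ M := (by norm_num : 4 ≤ 2 ^ 2).trans (Nat.pow_le_pow_right two_pos (by omega))
  have hcard : (Set.Ico M (2 * M) ∩ B).ncard = #s := by
    rw [← Set.ncard_coe_finset]
    congr 1
    ext n
    simp [s]
  rw [hcard] at hk
  have hk4' : (4 : ℝ) ≤ k := by exact_mod_cast hk4
  have hlogM : log M = k * log 2 := by simp [hMdef]
  have hlog2 : 1 / 2 < log 2 := by linarith [log_two_gt_d9]
  have hlog2' : log 2 < 1 := by linarith [log_two_lt_d9]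
  have hlogM1 : 1 < log M := by rw [hlogM]; nlinarith
  have hlogMk : log M ≤ k + 1 := by rw [hlogM]; nlinarith
  have hLpos : 0 < log (log M) := log_pos hlogM1
  have hLle : log (log M) ≤ log (k + 1) := log_le_log (by linarith) hlogMk
  have hMpos : (0 : ℝ) < M := by positivity
  have hcardsq := card_sq_le_mul_sum_totient_div_sq (by omega : 0 < M) s (filter_subset _ _)
  have hterm : ∑ n ∈ s, (n.totient : ℝ) / n ^ 2 ≤
      ((k : ℝ) + 1) ^ t * ∑ n ∈ Ico M (2 * M), Set.indicator {n : ℕ | n ∈ B ∧ 3 ≤ n} F n := by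
    rw [mul_sum, sum_filter]
    refine sum_le_sum fun n hn ↦ ?_
    obtain ⟨hn1, hn2⟩ := mem_Ico.1 hn
    by_cases hnB : n ∈ B
    · rw [if_pos hnB, Set.indicator_of_mem (by exact ⟨hnB, by omega⟩)]
      have hn0 : (0 : ℝ) < n := by exact_mod_cast (by omega : 0 < n)
      have hlogn1 : 1 < log n :=
        hlogM1.trans_le (log_le_log hMpos (by exact_mod_cast hn1))
      have hlognk : log n ≤ k + 1 := by
        have : log n ≤ log (2 * M) := log_le_log hn0 (by exact_mod_cast hn2.le)
        rw [log_mul two_ne_zero hMpos.ne', hlogM] at this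
        nlinarith
      have hrpow : log n ^ h ≤ ((k : ℝ) + 1) ^ t :=
        (rpow_le_rpow_of_exponent_le hlogn1.le (le_max_left _ _)).trans
          (rpow_le_rpow (by linarith) hlognk (le_max_right _ _))
      have hpos : 0 < log n ^ h := rpow_pos_of_pos (by linarith) _
      calc (n.totient : ℝ) / n ^ 2 = log n ^ h * F n := by rw [hF]; field_simp
        _ ≤ _ := mul_le_mul_of_nonneg_right hrpow (hF0 n)
    · rw [if_neg hnB, Set.indicator_of_notMem (fun hmem ↦ hnB hmem.1), mul_zero]
  set A := ∑ n ∈ Ico M (2 * M), Set.indicator {n : ℕ | n ∈ B ∧ 3 ≤ n} F n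
  have hA0 : 0 ≤ A := sum_nonneg fun n _ ↦ Set.indicator_nonneg (fun n _ ↦ hF0 n) n
  have hlower : c ^ 2 ≤ 16 * (k + 1) * A := by
    have h1 : c * M ≤ #s * log (log M) ^ 2 := (div_le_iff₀ (by positivity)).1 hk
    have h2 : c ^ 2 * M ^ 2 ≤ 16 * (k + 1) * A * M ^ 2 :=
      calc c ^ 2 * (M : ℝ) ^ 2 = (c * M) ^ 2 := by ring
        _ ≤ (#s * log (log M) ^ 2) ^ 2 := by gcongr
        _ = (#s : ℝ) ^ 2 * log (log M) ^ 4 := by ring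
        _ ≤ (16 * M ^ 2 * (((k : ℝ) + 1) ^ t * A)) * log (k + 1) ^ 4 := by
            gcongr
            exact hcardsq.trans (by gcongr)
        _ = 16 * M ^ 2 * A * (log (k + 1) ^ 4 * ((k : ℝ) + 1) ^ t) := by ring
        _ ≤ 16 * M ^ 2 * A * (k + 1) := by gcongr
        _ = _ := by ring
    exact le_of_mul_le_mul_right h2 (by positivity)
  rw [norm_of_nonneg (by positivity), div_mul_eq_mul_div, Nat.cast_add_one,
    div_le_div_iff₀ (by positivity) (by positivity)]
  linarith
end

section
/- There exists a constant c > 0 such that for all sufficiently large M the following holds. Set K = (log M)^{5/8}. For every m ≤ M·K all of whose prime divisors are ≡ 1 mod 4 and every k with K/2 ≤ k ≤ K all of whose prime divisors are ≡ 3 mod 4, one has Σ_{Mk+m ≤ l < 2Mk+m, l ≡ m (mod k)} b(l) ≥ c·M/√(log M). -/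
open Real Filter Finset
open scoped Classical

/-- `n` is a sum of two squares. -/
def IsSumTwoSquares (n : ℕ) : Prop := ∃ x y : ℤ, (n : ℤ) = x ^ 2 + y ^ 2

/-- Indicator function of the sums of two squares. -/
noncomputable def b (n : ℕ) : ℕ := if IsSumTwoSquares n then 1 else 0

/-- A Chebyshev-type upper bound for `∑ log p / p`. -/
theorem sum_log_div_prime_le (n : ℕ) :
    ∑ p ∈ (range (n + 1)).filter Nat.Prime, Real.log p / p ≤ 2 * Real.log n := by
  rcases Nat.eq_zero_or_pos n with rfl | hn
  · simp [Finset.filter_singleton, Nat.not_prime_zero]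
  set s := (range (n + 1)).filter Nat.Prime with hs
  have hsp : ∀ p ∈ s, p.Prime ∧ p ≤ n := fun p hp => by
    rw [hs, Finset.mem_filter, Finset.mem_range] at hp
    exact ⟨hp.2, by omega⟩
  have hdvd : ∏ p ∈ s, p ^ (n / p) ∣ n.factorial := by
    refine Finset.prod_dvd_of_isRelPrime ?_ ?_
    · intro p hp q hq hpq
      exact Nat.coprime_iff_isRelPrime.1
        (Nat.Coprime.pow _ _ ((Nat.coprime_primes (hsp p hp).1 (hsp q hq).1).2 hpq))
    · intro p hp
      rw [(hsp p hp).1.pow_dvd_factorial_iff (b := Nat.log p n + 2) (by omega)]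
      calc n / p = ∑ i ∈ Finset.Ico 1 2, n / p ^ i := by simp
        _ ≤ _ := Finset.sum_le_sum_of_subset (Finset.Ico_subset_Ico le_rfl (by omega))
  have h1 : ∑ p ∈ s, ((n / p : ℕ) : ℝ) * Real.log p ≤ n * Real.log n := by
    have h2 : (∏ p ∈ s, p ^ (n / p) : ℕ) ≤ n ^ n :=
      (Nat.le_of_dvd (Nat.factorial_pos n) hdvd).trans (Nat.factorial_le_pow n)
    have h3 : Real.log ((∏ p ∈ s, p ^ (n / p) : ℕ) : ℝ) ≤ Real.log ((n ^ n : ℕ) : ℝ) := by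
      apply Real.log_le_log
      · exact_mod_cast Finset.prod_pos fun p hp => pow_pos (hsp p hp).1.pos _
      · exact_mod_cast h2
    push_cast at h3
    rw [Real.log_prod (fun p hp => pow_ne_zero _ (by exact_mod_cast (hsp p hp).1.ne_zero)),
      Real.log_pow] at h3
    simpa [Real.log_pow] using h3
  have h4 : ∑ p ∈ s, (n : ℝ) / 2 * (Real.log p / p) ≤
      ∑ p ∈ s, ((n / p : ℕ) : ℝ) * Real.log p := by
    refine Finset.sum_le_sum fun p hp => ?_
    obtain ⟨hp1, hpn⟩ := hsp p hp
    have hp0 : (0 : ℝ) < p := by exact_mod_cast hp1.pos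
    have hl : 0 ≤ Real.log p := Real.log_natCast_nonneg p
    have h5 : (n : ℝ) / 2 / p ≤ ((n / p : ℕ) : ℝ) := by
      rw [div_div, div_le_iff₀ (by positivity)]
      have h6 := Nat.div_add_mod n p
      have h7 := Nat.mod_lt n hp1.pos
      have h8 : 1 ≤ n / p := Nat.div_pos hpn hp1.pos
      have : n ≤ (n / p) * (2 * p) := by nlinarith
      exact_mod_cast this
    calc (n : ℝ) / 2 * (Real.log p / p) = (n : ℝ) / 2 / p * Real.log p := by ring
      _ ≤ _ := mul_le_mul_of_nonneg_right h5 hl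
  rw [← Finset.mul_sum] at h4
  have hn' : (0 : ℝ) < n := by exact_mod_cast hn
  have h9 := h4.trans h1
  have h10 : (n : ℝ) / 2 * ∑ p ∈ s, Real.log p / p ≤ n / 2 * (2 * Real.log n) := by linarith
  exact le_of_mul_le_mul_left h10 (by positivity)

theorem sum_powerset_prod_mul_sum_le {ι : Type*} (P : Finset ι) (f g : ι → ℝ)
    (hf : ∀ i ∈ P, 0 ≤ f i) (hg : ∀ i ∈ P, 0 ≤ g i) :
    ∑ u ∈ P.powerset, (∏ i ∈ u, f i) * ∑ i ∈ u, g i ≤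
      (∏ i ∈ P, (1 + f i)) * ∑ i ∈ P, f i * g i := by
  induction P using Finset.induction_on with
  | empty => simp
  | insert a P ha ih =>
    have ih := ih (fun i hi => hf i (Finset.mem_insert_of_mem hi))
      (fun i hi => hg i (Finset.mem_insert_of_mem hi))
    have hfa := hf a (Finset.mem_insert_self a P)
    have hga := hg a (Finset.mem_insert_self a P)
    rw [Finset.sum_powerset_insert ha, Finset.prod_insert ha, Finset.sum_insert ha]
    have h1 : ∑ u ∈ P.powerset, (∏ i ∈ insert a u, f i) * ∑ i ∈ insert a u, g i =
        f a * g a * ∏ i ∈ P, (1 + f i) +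
          f a * ∑ u ∈ P.powerset, (∏ i ∈ u, f i) * ∑ i ∈ u, g i := by
      rw [Finset.prod_one_add, Finset.mul_sum, Finset.mul_sum, ← Finset.sum_add_distrib]
      refine Finset.sum_congr rfl fun u hu => ?_
      have hau : a ∉ u := fun h => ha (Finset.mem_powerset.1 hu h)
      rw [Finset.prod_insert hau, Finset.sum_insert hau]
      ring
    have hW : 0 ≤ ∏ i ∈ P, (1 + f i) := Finset.prod_nonneg fun i hi => by
      have := hf i (Finset.mem_insert_of_mem hi); linarith
    rw [h1]
    nlinarith [mul_le_mul_of_nonneg_left ih hfa,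
      mul_nonneg (mul_nonneg hfa (mul_nonneg hfa hga)) hW]

/-- The products of at most `z ^ 4` carry at least half of `∏ (1 + 1 / p)`. -/
theorem half_prod_le_sum_inv_prod (P : Finset ℕ) (z : ℕ) (hz : 2 ≤ z)
    (hP : ∀ p ∈ P, p.Prime ∧ p ≤ z) :
    (∏ p ∈ P, (1 + 1 / (p : ℝ))) / 2 ≤
      ∑ u ∈ P.powerset with ∏ p ∈ u, p ≤ z ^ 4, 1 / ((∏ p ∈ u, p : ℕ) : ℝ) := by
  have hz' : (2 : ℝ) ≤ z := by exact_mod_cast hz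
  have hlz : 0 < Real.log z := Real.log_pos (by linarith)
  have hmom := sum_powerset_prod_mul_sum_le P (fun p => 1 / (p : ℝ)) (fun p => Real.log p)
    (fun p _ => by positivity) (fun p _ => Real.log_natCast_nonneg p)
  have hsum : ∑ p ∈ P, 1 / (p : ℝ) * Real.log p ≤ 2 * Real.log z := by
    refine le_trans ?_ (sum_log_div_prime_le z)
    calc ∑ p ∈ P, 1 / (p : ℝ) * Real.log p = ∑ p ∈ P, Real.log p / p :=
          Finset.sum_congr rfl fun p _ => by ring
      _ ≤ _ := Finset.sum_le_sum_of_subset_of_nonneg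
          (fun p hp => by
            rw [Finset.mem_filter, Finset.mem_range]
            exact ⟨Nat.lt_succ_of_le (hP p hp).2, (hP p hp).1⟩)
          (fun p _ _ => div_nonneg (Real.log_natCast_nonneg p) (Nat.cast_nonneg p))
  have hW : 0 ≤ ∏ p ∈ P, (1 + 1 / (p : ℝ)) := Finset.prod_nonneg fun p _ => by positivity
  have hWe : ∏ p ∈ P, (1 + 1 / (p : ℝ)) = ∑ u ∈ P.powerset, ∏ p ∈ u, 1 / (p : ℝ) :=
    Finset.prod_one_add P
  have hsplit := Finset.sum_filter_add_sum_filter_not P.powerset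
    (fun u => ∏ p ∈ u, p ≤ z ^ 4) (fun u => ∏ p ∈ u, 1 / (p : ℝ))
  have htail : (4 * Real.log z) *
      ∑ u ∈ P.powerset with ¬ ∏ p ∈ u, p ≤ z ^ 4, ∏ p ∈ u, 1 / (p : ℝ) ≤
      ∑ u ∈ P.powerset, (∏ p ∈ u, 1 / (p : ℝ)) * ∑ p ∈ u, Real.log p := by
    rw [Finset.mul_sum]
    refine le_trans (Finset.sum_le_sum fun u hu => ?_)
      (Finset.sum_le_sum_of_subset_of_nonneg (Finset.filter_subset _ _) fun u _ _ =>
        mul_nonneg (Finset.prod_nonneg fun p _ => by positivity)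
          (Finset.sum_nonneg fun p _ => Real.log_natCast_nonneg p))
    rw [Finset.mem_filter, Finset.mem_powerset] at hu
    have hne : ∀ p ∈ u, (p : ℝ) ≠ 0 := fun p hp => by
      exact_mod_cast (hP p (hu.1 hp)).1.ne_zero
    rw [mul_comm]
    refine mul_le_mul_of_nonneg_left ?_ (Finset.prod_nonneg fun p _ => by positivity)
    rw [← Real.log_prod hne]
    calc 4 * Real.log z = Real.log ((z : ℝ) ^ 4) := by rw [Real.log_pow]; norm_num
      _ ≤ _ := Real.log_le_log (by positivity) (by
          rw [← Nat.cast_prod]; exact_mod_cast (not_le.1 hu.2).le)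
  have hcast : ∑ u ∈ P.powerset with ∏ p ∈ u, p ≤ z ^ 4, 1 / ((∏ p ∈ u, p : ℕ) : ℝ) =
      ∑ u ∈ P.powerset with ∏ p ∈ u, p ≤ z ^ 4, ∏ p ∈ u, 1 / (p : ℝ) :=
    Finset.sum_congr rfl fun u _ => by push_cast; rw [Finset.prod_div_distrib]; simp
  rw [hcast]
  have h5 := htail.trans (hmom.trans (mul_le_mul_of_nonneg_left hsum hW))
  have h6 : ∑ u ∈ P.powerset with ¬ ∏ p ∈ u, p ≤ z ^ 4, ∏ p ∈ u, 1 / (p : ℝ) ≤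
      (∏ p ∈ P, (1 + 1 / (p : ℝ))) / 2 := by
    refine le_of_mul_le_mul_left (h5.trans (le_of_eq ?_)) (by positivity : 0 < 4 * Real.log z)
    ring
  rw [hWe] at h6 ⊢
  linarith

theorem GaussianInt.norm_eq_sq_add_sq (z : GaussianInt) : z.norm = z.re ^ 2 + z.im ^ 2 := by
  rw [Zsqrtd.norm_def]; ring

theorem GaussianInt.prime_of_norm_prime {z : GaussianInt} {p : ℕ} (hp : p.Prime)
    (hz : z.norm = p) : Prime z := by
  apply Irreducible.prime
  constructor
  · intro hu
    rw [← Zsqrtd.norm_eq_one_iff, hz] at hu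
    exact hp.one_lt.ne' (by simpa using hu)
  · intro a b hab
    have h1 : a.norm.natAbs * b.norm.natAbs = p := by
      rw [← Int.natAbs_mul, ← Zsqrtd.norm_mul, ← hab, hz]; simp
    have h2 := (Nat.prime_mul_iff (a := a.norm.natAbs) (b := b.norm.natAbs)).1 (h1 ▸ hp)
    rcases h2 with ⟨_, h⟩ | ⟨_, h⟩
    · right; exact Zsqrtd.norm_eq_one_iff.1 h
    · left; exact Zsqrtd.norm_eq_one_iff.1 h

theorem GaussianInt.norm_dvd_norm {a c : GaussianInt} (h : a ∣ c) : a.norm ∣ c.norm := by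
  obtain ⟨d, rfl⟩ := h
  rw [Zsqrtd.norm_mul]
  exact dvd_mul_right _ _

theorem GaussianInt.not_dvd_star {z : GaussianInt} {p : ℕ} (hp : p.Prime) (hp2 : p ≠ 2)
    (hz : z.norm = p) : ¬ z ∣ star z := by
  intro h
  have h1 : z ∣ ((2 * z.re : ℤ) : GaussianInt) := by
    have h2 := dvd_add (dvd_refl z) h
    have h3 : z + star z = ((2 * z.re : ℤ) : GaussianInt) := by
      ext <;> simp; ring
    rwa [h3] at h2
  have h2 := GaussianInt.norm_dvd_norm h1
  rw [hz, Zsqrtd.norm_intCast] at h2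
  have hpp : Prime (p : ℤ) := Nat.prime_iff_prime_int.1 hp
  have h3 : (p : ℤ) ∣ z.re := by
    have h4 : (p : ℤ) ∣ 2 * z.re := by
      rcases hpp.dvd_or_dvd h2 with h | h <;> exact h
    rcases hpp.dvd_or_dvd h4 with h | h
    · exfalso
      have : p ∣ 2 := by exact_mod_cast h
      exact hp2 ((Nat.prime_dvd_prime_iff_eq hp Nat.prime_two).1 this)
    · exact h
  rw [GaussianInt.norm_eq_sq_add_sq] at hz
  have h5 : (p : ℤ) ∣ z.im := by
    have : (p : ℤ) ∣ z.im ^ 2 := by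
      have h6 : z.im ^ 2 = p - z.re ^ 2 := by linarith
      rw [h6]
      exact dvd_sub (dvd_refl _) (dvd_pow h3 two_ne_zero)
    exact hpp.dvd_of_dvd_pow this
  obtain ⟨a, ha⟩ := h3
  obtain ⟨c, hc⟩ := h5
  rw [ha, hc] at hz
  have h7 : (p : ℤ) * (p * (a ^ 2 + c ^ 2)) = p * 1 := by linarith
  have h8 := mul_left_cancel₀ (by exact_mod_cast hp.ne_zero) h7
  exact hpp.not_isUnit (IsUnit.of_mul_eq_one _ h8)

section GaussianProducts

variable {P : Finset ℕ} {ϖ : ℕ → GaussianInt}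

theorem gaussian_factor_dvd_prod_iff (hP : ∀ p ∈ P, p.Prime ∧ p ≠ 2)
    (hϖ : ∀ p ∈ P, (ϖ p).norm = p) {u v : Finset ℕ} (hu : u ⊆ P) (hv : v ⊆ P)
    {p : ℕ} (hp : p ∈ P) :
    ϖ p ∣ (∏ q ∈ u, ϖ q) * ∏ q ∈ v, star (ϖ q) ↔ p ∈ u := by
  constructor
  · intro h
    have hpr := GaussianInt.prime_of_norm_prime (hP p hp).1 (hϖ p hp)
    have heq : ∀ q ∈ P, ∀ w : GaussianInt, w.norm = q → ϖ p ∣ w → p = q := by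
      intro q hq w hw hd
      have h1 := GaussianInt.norm_dvd_norm hd
      rw [hw, hϖ p hp] at h1
      exact (Nat.prime_dvd_prime_iff_eq (hP p hp).1 (hP q hq).1).1 (by exact_mod_cast h1)
    rcases hpr.dvd_or_dvd h with h | h
    · obtain ⟨q, hq, hd⟩ := (hpr.dvd_finsetProd_iff _).1 h
      rw [heq q (hu hq) _ (hϖ q (hu hq)) hd]
      exact hq
    · obtain ⟨q, hq, hd⟩ := (hpr.dvd_finsetProd_iff _).1 h
      have h2 := heq q (hv hq) _ (by rw [Zsqrtd.norm_conj, hϖ q (hv hq)]) hd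
      rw [← h2] at hd
      exact absurd hd (GaussianInt.not_dvd_star (hP p hp).1 (hP p hp).2 (hϖ p hp))
  · intro h
    exact (Finset.dvd_prod_of_mem ϖ h).mul_right _

theorem gaussian_prod_injective (hP : ∀ p ∈ P, p.Prime ∧ p ≠ 2)
    (hϖ : ∀ p ∈ P, (ϖ p).norm = p) {u v u' v' : Finset ℕ} (hu : u ⊆ P) (hv : v ⊆ P)
    (hu' : u' ⊆ P) (hv' : v' ⊆ P)
    (h : (∏ q ∈ u, ϖ q) * ∏ q ∈ v, star (ϖ q) = (∏ q ∈ u', ϖ q) * ∏ q ∈ v', star (ϖ q)) :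
    u = u' ∧ v = v' := by
  have key : ∀ {u v u' v' : Finset ℕ}, u ⊆ P → v ⊆ P → u' ⊆ P → v' ⊆ P →
      (∏ q ∈ u, ϖ q) * ∏ q ∈ v, star (ϖ q) = (∏ q ∈ u', ϖ q) * ∏ q ∈ v', star (ϖ q) →
      u = u' := by
    intro u v u' v' hu hv hu' hv' h
    ext p
    constructor
    · intro hp
      rwa [← gaussian_factor_dvd_prod_iff hP hϖ hu' hv' (hu hp), ← h,
        gaussian_factor_dvd_prod_iff hP hϖ hu hv (hu hp)]
    · intro hp
      rwa [← gaussian_factor_dvd_prod_iff hP hϖ hu hv (hu' hp), h,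
        gaussian_factor_dvd_prod_iff hP hϖ hu' hv' (hu' hp)]
  refine ⟨key hu hv hu' hv' h, key hv hu hv' hu' ?_⟩
  have h2 := congrArg star h
  simp only [star_mul, star_prod, star_star] at h2
  exact h2

end GaussianProducts

/-- A logarithmic bound for `∑ 1 / (x ^ 2 + y ^ 2)` over lattice points. -/
theorem sum_inv_norm_le (Z : Finset (ℤ × ℤ)) (S : ℕ)
    (hZ : ∀ w ∈ Z, w ≠ 0 ∧ w.1 ^ 2 + w.2 ^ 2 ≤ (S : ℤ) ^ 2) :
    ∑ w ∈ Z, 1 / ((w.1 : ℝ) ^ 2 + (w.2 : ℝ) ^ 2) ≤ 8 * (1 + Real.log S) := by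
  set f : ℤ × ℤ → ℕ := fun w => max w.1.natAbs w.2.natAbs with hf
  have hmaps : ∀ w ∈ Z, f w ∈ Finset.Icc 1 S := by
    intro w hw
    obtain ⟨h0, hS⟩ := hZ w hw
    rw [Finset.mem_Icc]
    constructor
    · by_contra hlt
      apply h0
      have h1 : w.1.natAbs ≤ f w := le_max_left _ _
      have h2 : w.2.natAbs ≤ f w := le_max_right _ _
      ext <;> simp <;> omega
    · apply max_le
      · have := abs_le_of_sq_le_sq (show w.1 ^ 2 ≤ (S : ℤ) ^ 2 by nlinarith [sq_nonneg w.2])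
          (by positivity)
        rw [Int.abs_eq_natAbs] at this
        omega
      · have := abs_le_of_sq_le_sq (show w.2 ^ 2 ≤ (S : ℤ) ^ 2 by nlinarith [sq_nonneg w.1])
          (by positivity)
        rw [Int.abs_eq_natAbs] at this
        omega
  rw [← Finset.sum_fiberwise_of_maps_to hmaps]
  have hj : ∀ j ∈ Finset.Icc 1 S,
      ∑ w ∈ Z with f w = j, 1 / ((w.1 : ℝ) ^ 2 + (w.2 : ℝ) ^ 2) ≤ 8 * ((j : ℝ))⁻¹ := by
    intro j hj
    have hj1 : 1 ≤ j := (Finset.mem_Icc.1 hj).1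
    have hj0 : (0 : ℝ) < j := by exact_mod_cast hj1
    have hcard : #(Z.filter fun w => f w = j) ≤ 8 * j := by
      rw [← Int.card_box (n := j) (by omega)]
      apply Finset.card_le_card
      intro w hw
      rw [Int.mem_box]
      exact (Finset.mem_filter.1 hw).2
    calc _ ≤ ∑ w ∈ Z with f w = j, 1 / (j : ℝ) ^ 2 := by
          refine Finset.sum_le_sum fun w hw => ?_
          have hw' : f w = j := (Finset.mem_filter.1 hw).2
          refine one_div_le_one_div_of_le (by positivity) ?_
          have hcase : w.1.natAbs = j ∨ w.2.natAbs = j := by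
            rcases max_choice w.1.natAbs w.2.natAbs with h | h
            · left; rw [← h]; exact hw'
            · right; rw [← h]; exact hw'
          have hsq : ∀ t : ℤ, t.natAbs = j → (t : ℝ) ^ 2 = (j : ℝ) ^ 2 := by
            intro t ht
            have : t ^ 2 = (j : ℤ) ^ 2 := by rw [← ht, Int.natAbs_sq]
            exact_mod_cast this
          rcases hcase with h | h
          · rw [hsq _ h]; nlinarith [sq_nonneg (w.2 : ℝ)]
          · rw [hsq _ h]; nlinarith [sq_nonneg (w.1 : ℝ)]
      _ = #(Z.filter fun w => f w = j) * (1 / (j : ℝ) ^ 2) := by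
          rw [Finset.sum_const, nsmul_eq_mul]
      _ ≤ (8 * j : ℝ) * (1 / (j : ℝ) ^ 2) := by
          refine mul_le_mul_of_nonneg_right ?_ (by positivity)
          exact_mod_cast hcard
      _ = _ := by field_simp
  refine (Finset.sum_le_sum hj).trans ?_
  rw [← Finset.mul_sum]
  refine mul_le_mul_of_nonneg_left ?_ (by norm_num)
  have h := harmonic_le_one_add_log S
  rw [harmonic_eq_sum_Icc] at h
  push_cast at h
  exact h

/-- The reciprocal sum over squarefree products `≤ S` of primes `≡ 1 (mod 4)` is
`O(√log S)`. -/
theorem sq_sum_inv_prod_le (P : Finset ℕ) (hP : ∀ p ∈ P, p.Prime ∧ p % 4 = 1)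
    (S : ℕ) :
    (∑ u ∈ P.powerset with ∏ p ∈ u, p ≤ S, 1 / ((∏ p ∈ u, p : ℕ) : ℝ)) ^ 2 ≤
      8 * (1 + Real.log S) := by
  have hex : ∀ p ∈ P, ∃ z : GaussianInt, z.norm = p := by
    intro p hp
    have : Fact p.Prime := ⟨(hP p hp).1⟩
    obtain ⟨x, y, hxy⟩ := Nat.Prime.sq_add_sq (p := p) (by have := (hP p hp).2; omega)
    refine ⟨⟨x, y⟩, ?_⟩
    rw [GaussianInt.norm_eq_sq_add_sq]
    show (x : ℤ) ^ 2 + (y : ℤ) ^ 2 = p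
    exact_mod_cast hxy
  choose! ϖ hϖ using hex
  have hP2 : ∀ p ∈ P, p.Prime ∧ p ≠ 2 := fun p hp => ⟨(hP p hp).1, by
    rintro rfl; have := (hP 2 hp).2; omega⟩
  set U := P.powerset.filter fun u => ∏ p ∈ u, p ≤ S with hU
  have hUP : ∀ u ∈ U, u ⊆ P ∧ ∏ p ∈ u, p ≤ S := fun u hu => by
    rw [hU, Finset.mem_filter, Finset.mem_powerset] at hu; exact hu
  set F : Finset ℕ × Finset ℕ → ℤ × ℤ := fun w =>
    (((∏ q ∈ w.1, ϖ q) * ∏ q ∈ w.2, star (ϖ q)).re,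
      ((∏ q ∈ w.1, ϖ q) * ∏ q ∈ w.2, star (ϖ q)).im) with hF
  have hnprod : ∀ u ⊆ P, (∏ q ∈ u, ϖ q).norm = ((∏ q ∈ u, q : ℕ) : ℤ) := by
    intro u hu
    have h1 : (∏ q ∈ u, ϖ q).norm = ∏ q ∈ u, (ϖ q).norm :=
      map_prod (Zsqrtd.normMonoidHom (d := -1)) ϖ u
    rw [h1, Finset.prod_congr rfl fun q hq => hϖ q (hu hq)]
    push_cast; rfl
  have hFn : ∀ w ∈ U ×ˢ U, (F w).1 ^ 2 + (F w).2 ^ 2 =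
      (((∏ p ∈ w.1, p : ℕ) * (∏ p ∈ w.2, p : ℕ) : ℕ) : ℤ) := by
    intro w hw
    rw [Finset.mem_product] at hw
    rw [hF]
    simp only
    rw [← GaussianInt.norm_eq_sq_add_sq, Zsqrtd.norm_mul, ← star_prod, Zsqrtd.norm_conj,
      hnprod _ (hUP _ hw.1).1, hnprod _ (hUP _ hw.2).1]
    push_cast; rfl
  have hpos : ∀ u ∈ U, 0 < ∏ p ∈ u, p := fun u hu =>
    Finset.prod_pos fun p hp => (hP p ((hUP u hu).1 hp)).1.pos
  have hinj : Set.InjOn F (U ×ˢ U : Finset _) := by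
    intro w hw w' hw' h
    rw [Finset.mem_coe, Finset.mem_product] at hw hw'
    rw [hF] at h
    simp only [Prod.mk.injEq] at h
    have h2 := gaussian_prod_injective hP2 hϖ (hUP _ hw.1).1 (hUP _ hw.2).1
      (hUP _ hw'.1).1 (hUP _ hw'.2).1 (Zsqrtd.ext h.1 h.2)
    exact Prod.ext h2.1 h2.2
  have hmain := sum_inv_norm_le ((U ×ˢ U).image F) S (by
    intro w hw
    obtain ⟨w', hw', rfl⟩ := Finset.mem_image.1 hw
    have h1 := hFn w' hw'
    rw [Finset.mem_product] at hw'
    have h2 := hpos _ hw'.1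
    have h3 := hpos _ hw'.2
    constructor
    · intro h0
      rw [h0] at h1
      have : 0 < (∏ p ∈ w'.1, p) * ∏ p ∈ w'.2, p := Nat.mul_pos h2 h3
      simp only [Prod.fst_zero, Prod.snd_zero] at h1
      omega
    · rw [h1, sq]
      exact_mod_cast Nat.mul_le_mul (hUP _ hw'.1).2 (hUP _ hw'.2).2)
  rw [Finset.sum_image hinj] at hmain
  refine le_trans (le_of_eq ?_) hmain
  rw [sq, Finset.sum_mul_sum, ← Finset.sum_product']
  refine Finset.sum_congr rfl fun w hw => ?_
  have h1 : ((F w).1 : ℝ) ^ 2 + ((F w).2 : ℝ) ^ 2 =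
      (((∏ p ∈ w.1, p : ℕ) * (∏ p ∈ w.2, p : ℕ) : ℕ) : ℝ) := by exact_mod_cast hFn w hw
  rw [h1, Nat.cast_mul, one_div_mul_one_div]

theorem GaussianInt.exists_card_eq_of_forall_dvd {Z : Finset GaussianInt} {ϖ : GaussianInt}
    {n m : ℤ} (hϖ : ϖ.norm ≠ 0) (hnm : n = ϖ.norm * m) (hZ : ∀ z ∈ Z, z.norm = n ∧ ϖ ∣ z) :
    ∃ Z' : Finset GaussianInt, #Z' = #Z ∧ ∀ z ∈ Z', z.norm = m := by
  have h : ∀ z ∈ Z, ∃ w, z = ϖ * w := fun z hz => (hZ z hz).2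
  choose! w hw using h
  refine ⟨Z.image w, Finset.card_image_of_injOn ?_, ?_⟩
  · intro z hz z' hz' he
    rw [hw z hz, hw z' hz', he]
  · intro y hy
    obtain ⟨z, hz, rfl⟩ := Finset.mem_image.1 hy
    have h1 := (hZ z hz).1
    rw [hw z hz, Zsqrtd.norm_mul, hnm] at h1
    exact mul_left_cancel₀ hϖ h1

/-- The number of representations by `x ^ 2 + y ^ 2` is bounded in terms of the number of
prime factors `≡ 1 (mod 4)`. -/
theorem GaussianInt.card_norm_eq_le (T n : ℕ) :
    ∀ (j : ℕ) (Z : Finset GaussianInt), 1 ≤ n → n < T ^ j →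
    (∀ p : ℕ, p.Prime → p % 4 = 1 → p ∣ n → T ≤ p) → (∀ z ∈ Z, z.norm = n) →
    #Z ≤ 4 * 2 ^ j := by
  induction n using Nat.strong_induction_on with
  | _ n ih =>
  intro j Z hn hj hp hZ
  rcases Nat.lt_or_ge 1 n with h1 | h1
  swap
  · have hn1 : n = 1 := by omega
    subst hn1
    have hsub : Z ⊆ {⟨1, 0⟩, ⟨-1, 0⟩, ⟨0, 1⟩, ⟨0, -1⟩} := by
      intro z hz
      have h2 := hZ z hz
      rw [GaussianInt.norm_eq_sq_add_sq] at h2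
      push_cast at h2
      have h3 : -1 ≤ z.re ∧ z.re ≤ 1 := by constructor <;> nlinarith [sq_nonneg z.im]
      have h4 : -1 ≤ z.im ∧ z.im ≤ 1 := by constructor <;> nlinarith [sq_nonneg z.re]
      obtain ⟨x, y⟩ := z
      simp only at h2 h3 h4
      obtain ⟨h3a, h3b⟩ := h3
      obtain ⟨h4a, h4b⟩ := h4
      interval_cases x <;> interval_cases y <;> simp_all
    calc #Z ≤ 4 := (Finset.card_le_card hsub).trans Finset.card_le_four
      _ ≤ 4 * 2 ^ j := Nat.le_mul_of_pos_right _ (by positivity)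
  obtain ⟨q, hq, hqn⟩ := Nat.exists_prime_and_dvd h1.ne'
  have hprod : ∀ z ∈ Z, z * star z = ((n : ℤ) : GaussianInt) := fun z hz => by
    rw [← hZ z hz, Zsqrtd.norm_eq_mul_conj]
  obtain ⟨m, rfl⟩ := hqn
  have hm1 : 1 ≤ m := Nat.pos_of_ne_zero (by rintro rfl; simp at hn)
  have hqdvd : ∀ z ∈ Z, ((q : ℤ) : GaussianInt) ∣ z * star z := fun z hz => by
    rw [hprod z hz]
    exact ⟨((m : ℤ) : GaussianInt), by push_cast; ring⟩
  have hor : ∀ ϖ : GaussianInt, ϖ.norm = q → ∀ z ∈ Z, ϖ ∣ z ∨ star ϖ ∣ z := by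
    intro ϖ hϖ z hz
    have h2 : ϖ ∣ z * star z := by
      refine Dvd.dvd.trans ?_ (hqdvd z hz)
      rw [← hϖ, Zsqrtd.norm_eq_mul_conj]
      exact dvd_mul_right _ _
    rcases (GaussianInt.prime_of_norm_prime hq hϖ).dvd_or_dvd h2 with h | h
    · exact Or.inl h
    · right
      obtain ⟨w, hw⟩ := h
      refine ⟨star w, ?_⟩
      rw [← star_star z, hw, star_mul, mul_comm]
  have hrec : ∀ (ϖ : GaussianInt) (i : ℕ) (Z' : Finset GaussianInt), ϖ.norm = q →
      Z' ⊆ Z → (∀ z ∈ Z', ϖ ∣ z) → m < T ^ i → #Z' ≤ 4 * 2 ^ i := by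
    intro ϖ i Z' hϖ hs hd hi
    obtain ⟨Z'', hc, hn''⟩ := GaussianInt.exists_card_eq_of_forall_dvd (Z := Z') (ϖ := ϖ)
      (n := ((q * m : ℕ) : ℤ)) (m := m) (by rw [hϖ]; exact_mod_cast hq.ne_zero)
      (by rw [hϖ]; push_cast; rfl) (fun z hz => ⟨hZ z (hs hz), hd z hz⟩)
    rw [← hc]
    exact ih m (by nlinarith [hq.two_le]) i Z'' hm1 hi
      (fun p hp1 hp2 hp3 => hp p hp1 hp2 (hp3.mul_left q)) hn''
  have hcases : q = 2 ∨ q % 4 = 1 ∨ q % 4 = 3 := by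
    rcases hq.eq_two_or_odd with h | h
    · exact Or.inl h
    · omega
  rcases hcases with rfl | h4 | h4
  · refine hrec ⟨1, 1⟩ j Z rfl subset_rfl ?_ (by nlinarith)
    intro z hz
    rcases hor ⟨1, 1⟩ rfl z hz with h | h
    · exact h
    · exact Dvd.dvd.trans ⟨⟨0, -1⟩, by ext <;> simp⟩ h
  · have hTq : T ≤ q := hp q hq h4 (dvd_mul_right _ _)
    have : Fact q.Prime := ⟨hq⟩
    obtain ⟨x, y, hxy⟩ := Nat.Prime.sq_add_sq (p := q) (by omega)
    have hϖ : (⟨x, y⟩ : GaussianInt).norm = q := by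
      rw [GaussianInt.norm_eq_sq_add_sq]
      show (x : ℤ) ^ 2 + (y : ℤ) ^ 2 = q
      exact_mod_cast hxy
    rcases j with _ | i
    · rw [pow_zero] at hj; omega
    have hi : m < T ^ i := by
      rw [pow_succ] at hj
      by_contra hcon
      have := Nat.mul_le_mul hTq (not_lt.1 hcon)
      rw [mul_comm T] at this
      omega
    have hcov : Z ⊆ (Z.filter fun z => (⟨x, y⟩ : GaussianInt) ∣ z) ∪
        Z.filter fun z => star (⟨x, y⟩ : GaussianInt) ∣ z := by
      intro z hz
      rw [Finset.mem_union, Finset.mem_filter, Finset.mem_filter]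
      rcases hor _ hϖ z hz with h | h
      · exact Or.inl ⟨hz, h⟩
      · exact Or.inr ⟨hz, h⟩
    have hA := hrec _ i _ hϖ (Finset.filter_subset (fun z => (⟨x, y⟩ : GaussianInt) ∣ z) Z)
      (fun z hz => (Finset.mem_filter.1 hz).2) hi
    have hB := hrec (star ⟨x, y⟩) i _ (by rw [Zsqrtd.norm_conj, hϖ])
      (Finset.filter_subset (fun z => star (⟨x, y⟩ : GaussianInt) ∣ z) Z)
      (fun z hz => (Finset.mem_filter.1 hz).2) hi
    calc #Z ≤ _ := Finset.card_le_card hcov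
      _ ≤ _ := Finset.card_union_le _ _
      _ ≤ 4 * 2 ^ i + 4 * 2 ^ i := add_le_add hA hB
      _ = _ := by ring
  · have : Fact q.Prime := ⟨hq⟩
    have hqp : Prime ((q : ℕ) : GaussianInt) :=
      GaussianInt.prime_of_nat_prime_of_mod_four_eq_three q h4
    have hall : ∀ z ∈ Z, ((q : ℤ) : GaussianInt) ∣ z := by
      intro z hz
      have h2 := hqdvd z hz
      rw [Int.cast_natCast] at h2 ⊢
      rcases hqp.dvd_or_dvd h2 with h | h
      · exact h
      · obtain ⟨w, hw⟩ := h
        refine ⟨star w, ?_⟩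
        rw [← star_star z, hw, star_mul, star_natCast, mul_comm]
    rcases Z.eq_empty_or_nonempty with rfl | ⟨z₀, hz₀⟩
    · simp
    have hqm : q ∣ m := by
      have h2 := GaussianInt.norm_dvd_norm (hall z₀ hz₀)
      rw [hZ z₀ hz₀, Zsqrtd.norm_intCast] at h2
      have h3 : q * q ∣ q * m := by exact_mod_cast h2
      exact Nat.dvd_of_mul_dvd_mul_left hq.pos h3
    obtain ⟨m', rfl⟩ := hqm
    have hm'1 : 1 ≤ m' := Nat.pos_of_ne_zero (by rintro rfl; simp at hn)
    obtain ⟨Z'', hc, hn''⟩ := GaussianInt.exists_card_eq_of_forall_dvd (Z := Z)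
      (ϖ := ((q : ℤ) : GaussianInt)) (n := ((q * (q * m') : ℕ) : ℤ)) (m := m')
      (by rw [Zsqrtd.norm_intCast]; exact_mod_cast Nat.mul_ne_zero hq.ne_zero hq.ne_zero)
      (by rw [Zsqrtd.norm_intCast]; push_cast; ring) (fun z hz => ⟨hZ z hz, hall z hz⟩)
    have h2q := hq.two_le
    have hlt : m' < q * (q * m') := by nlinarith [Nat.mul_le_mul h2q (Nat.mul_le_mul h2q hm'1)]
    rw [← hc]
    exact ih m' hlt j Z'' hm'1 (hlt.trans hj)
      (fun p hp1 hp2 hp3 => hp p hp1 hp2 ((hp3.mul_left q).mul_left q)) hn''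

theorem sum_powerset_union_mul {ι R : Type*} [DecidableEq ι] [CommSemiring R]
    {P Q : Finset ι} (h : Disjoint P Q) (F G : Finset ι → R) :
    ∑ u ∈ (P ∪ Q).powerset, F (u ∩ P) * G (u ∩ Q) =
      (∑ v ∈ P.powerset, F v) * ∑ w ∈ Q.powerset, G w := by
  rw [Finset.sum_mul_sum, ← Finset.sum_product']
  have hd : ∀ v ⊆ P, ∀ w ⊆ Q, (v ∪ w) ∩ P = v ∧ (v ∪ w) ∩ Q = w := by
    intro v hv w hw
    rw [Finset.union_inter_distrib_right, Finset.union_inter_distrib_right,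
      Finset.inter_eq_left.2 hv, Finset.inter_eq_left.2 hw,
      Finset.disjoint_iff_inter_eq_empty.1 (h.symm.mono_left hw),
      Finset.disjoint_iff_inter_eq_empty.1 (h.mono_left hv)]
    simp
  refine Finset.sum_nbij' (fun u => (u ∩ P, u ∩ Q)) (fun w => w.1 ∪ w.2) ?_ ?_ ?_ ?_ ?_
  · intro u _
    simp [Finset.mem_product, Finset.inter_subset_right]
  · intro w hw
    rw [Finset.mem_product, Finset.mem_powerset, Finset.mem_powerset] at hw
    exact Finset.mem_powerset.2 (Finset.union_subset_union hw.1 hw.2)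
  · intro u hu
    simp only
    rw [← Finset.inter_union_distrib_left, Finset.inter_eq_left.2 (Finset.mem_powerset.1 hu)]
  · intro w hw
    rw [Finset.mem_product, Finset.mem_powerset, Finset.mem_powerset] at hw
    obtain ⟨h1, h2⟩ := hd _ hw.1 _ hw.2
    exact Prod.ext h1 h2
  · intro u _
    rfl

/-- The Möbius function on finite sets, truncated to sets with fewer than `c` elements. -/
noncomputable def truncatedMoebius (c : ℕ) (u : Finset ℕ) : ℝ :=
  if #u < c then (-1) ^ #u else 0

theorem abs_truncatedMoebius_le (c : ℕ) (u : Finset ℕ) : |truncatedMoebius c u| ≤ 1 := by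
  unfold truncatedMoebius
  split_ifs <;> simp

theorem sum_truncatedMoebius_insert {Q : Finset ℕ} {a : ℕ} (ha : a ∉ Q) (c : ℕ) (g : ℕ → ℝ) :
    ∑ u ∈ (insert a Q).powerset, truncatedMoebius (c + 1) u * ∏ p ∈ u, g p =
      ∑ u ∈ Q.powerset, truncatedMoebius (c + 1) u * ∏ p ∈ u, g p -
        g a * ∑ u ∈ Q.powerset, truncatedMoebius c u * ∏ p ∈ u, g p := by
  rw [Finset.sum_powerset_insert ha, Finset.mul_sum, sub_eq_add_neg, ← Finset.sum_neg_distrib]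
  congr 1
  refine Finset.sum_congr rfl fun u hu => ?_
  have hau : a ∉ u := fun h => ha (Finset.mem_powerset.1 hu h)
  rw [Finset.prod_insert hau]
  unfold truncatedMoebius
  rw [Finset.card_insert_of_notMem hau]
  by_cases h : #u < c
  · rw [if_pos (by omega), if_pos h]; ring
  · rw [if_neg (by omega), if_neg h]; ring

/-- Weighted Bonferroni inequalities. -/
theorem bonferroni (Q : Finset ℕ) (g : ℕ → ℝ) (hg : ∀ p ∈ Q, 0 ≤ g p)
    (hb : ∀ p ∈ Q, g p ≤ 1) (c : ℕ) :
    (Odd c → ∏ p ∈ Q, (1 - g p) ≤ ∑ u ∈ Q.powerset, truncatedMoebius c u * ∏ p ∈ u, g p) ∧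
    (Even c → ∑ u ∈ Q.powerset, truncatedMoebius c u * ∏ p ∈ u, g p ≤
      ∏ p ∈ Q, (1 - g p)) := by
  induction Q using Finset.induction_on generalizing c with
  | empty =>
    rcases c with _ | c
    · simp [truncatedMoebius]
    · simp [truncatedMoebius]
  | insert a Q ha ih =>
    have hg' : ∀ p ∈ Q, 0 ≤ g p := fun p hp => hg p (Finset.mem_insert_of_mem hp)
    have hb' : ∀ p ∈ Q, g p ≤ 1 := fun p hp => hb p (Finset.mem_insert_of_mem hp)
    have hga := hg a (Finset.mem_insert_self a Q)
    have hV : 0 ≤ ∏ p ∈ insert a Q, (1 - g p) :=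
      Finset.prod_nonneg fun p hp => sub_nonneg.2 (hb p hp)
    rcases c with _ | c
    · refine ⟨fun h => by simp at h, fun _ => ?_⟩
      simpa [truncatedMoebius] using hV
    have ih1 := ih hg' (c := c + 1) hb'
    have ih0 := ih hg' (c := c) hb'
    rw [sum_truncatedMoebius_insert ha, Finset.prod_insert ha]
    constructor
    · intro hodd
      have h0 := ih0.2 (by rcases hodd with ⟨t, ht⟩; exact ⟨t, by omega⟩)
      have h1 := ih1.1 hodd
      nlinarith [mul_le_mul_of_nonneg_left h0 hga]
    · intro heven
      have h0 := ih0.1 (by rw [Nat.even_add_one] at heven; exact Nat.not_even_iff_odd.1 heven)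
      have h1 := ih1.2 heven
      nlinarith [mul_le_mul_of_nonneg_left h0 hga]

theorem pow_add_mul_pow_le {x y : ℝ} (hx : 0 ≤ x) (hy : 0 ≤ y) (c : ℕ) :
    y ^ (c + 1) + (c + 1) * x * y ^ c ≤ (x + y) ^ (c + 1) := by
  induction c with
  | zero => simp; linarith
  | succ c ih =>
    rw [pow_succ (x + y)]
    have h := mul_le_mul_of_nonneg_right ih (add_nonneg hx hy)
    have h2 : 0 ≤ (c + 1 : ℝ) * x * y ^ c * x := by positivity
    have h3 : (y ^ (c + 1) + (c + 1) * x * y ^ c) * (x + y) =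
        y ^ (c + 1 + 1) + (c + 1 + 1) * x * y ^ (c + 1) + (c + 1) * x * y ^ c * x := by ring
    push_cast
    linarith

theorem sum_powersetCard_prod_le (Q : Finset ℕ) (g : ℕ → ℝ) (hg : ∀ p ∈ Q, 0 ≤ g p) (c : ℕ) :
    ∑ u ∈ Q.powerset with #u = c, ∏ p ∈ u, g p ≤ (∑ p ∈ Q, g p) ^ c / c.factorial := by
  rw [← Finset.powersetCard_eq_filter]
  induction Q using Finset.induction_on generalizing c with
  | empty =>
    rcases c with _ | c
    · simp
    · rw [Finset.powersetCard_eq_empty.2 (by simp)]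
      simp
  | insert a Q ha ih =>
    have hg' : ∀ p ∈ Q, 0 ≤ g p := fun p hp => hg p (Finset.mem_insert_of_mem hp)
    have hga := hg a (Finset.mem_insert_self a Q)
    rcases c with _ | c
    · simp
    rw [Finset.powersetCard_succ_insert ha, Finset.sum_union (by
      rw [Finset.disjoint_left]
      intro u hu hu'
      obtain ⟨v, _, rfl⟩ := Finset.mem_image.1 hu'
      exact ha ((Finset.mem_powersetCard.1 hu).1 (Finset.mem_insert_self a v)))]
    have him : ∑ u ∈ (Q.powersetCard c).image (insert a), ∏ p ∈ u, g p =
        g a * ∑ u ∈ Q.powersetCard c, ∏ p ∈ u, g p := by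
      have hau : ∀ u ∈ Q.powersetCard c, a ∉ u := fun u hu h =>
        ha ((Finset.mem_powersetCard.1 hu).1 h)
      rw [Finset.sum_image, Finset.mul_sum]
      · exact Finset.sum_congr rfl fun u hu => Finset.prod_insert (hau u hu)
      · intro u hu v hv huv
        rw [← Finset.erase_insert (hau u hu), ← Finset.erase_insert (hau v hv), huv]
    rw [him, Finset.sum_insert ha]
    have hL : 0 ≤ ∑ p ∈ Q, g p := Finset.sum_nonneg hg'
    have h1 := ih hg' (c + 1)
    have h0 := mul_le_mul_of_nonneg_left (ih hg' c) hga
    refine (add_le_add h1 h0).trans ?_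
    have h2 := pow_add_mul_pow_le hga hL c
    rw [Nat.factorial_succ]
    push_cast
    have hc : (0 : ℝ) < c.factorial := by exact_mod_cast c.factorial_pos
    have hc1 : (0 : ℝ) < (c : ℝ) + 1 := by positivity
    rw [le_div_iff₀ (by positivity)]
    refine le_trans (le_of_eq ?_) h2
    field_simp

theorem sum_truncatedMoebius_succ (Q : Finset ℕ) (g : ℕ → ℝ) {c : ℕ} (hc : Odd c) :
    ∑ u ∈ Q.powerset, truncatedMoebius (c + 1) u * ∏ p ∈ u, g p =
      ∑ u ∈ Q.powerset, truncatedMoebius c u * ∏ p ∈ u, g p -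
        ∑ u ∈ Q.powerset with #u = c, ∏ p ∈ u, g p := by
  rw [Finset.sum_filter, ← Finset.sum_sub_distrib]
  refine Finset.sum_congr rfl fun u _ => ?_
  unfold truncatedMoebius
  rcases lt_trichotomy #u c with h | h | h
  · rw [if_pos (by omega), if_pos h, if_neg h.ne]; ring
  · rw [if_pos (by omega), if_neg (by omega), if_pos h, h, hc.neg_one_pow]; ring
  · rw [if_neg (by omega), if_neg (by omega), if_neg (by omega)]; ring

/-- Lower-bound sieve weights of Brun–Hooley type attached to ranges `Q i` truncated at `c i`. -/
theorem exists_sieve_weights (Q : ℕ → Finset ℕ) (hQ : ∀ i j, i ≠ j → Disjoint (Q i) (Q j))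
    (c Y : ℕ → ℕ) (hc : ∀ i, Odd (c i)) (hY : ∀ i, ∀ p ∈ Q i, p ≤ Y i) (hY1 : ∀ i, 1 ≤ Y i)
    (n : ℕ) :
    ∃ lam mu : Finset ℕ → ℝ,
      (∀ u ⊆ (range n).biUnion Q, lam u ≠ 0 → ∏ p ∈ u, p ≤ ∏ i ∈ range n, Y i ^ c i) ∧
      (∀ u ⊆ (range n).biUnion Q, mu u ≠ 0 → ∏ p ∈ u, p ≤ ∏ i ∈ range n, Y i ^ c i) ∧
      (∀ u, |lam u| ≤ 1) ∧ (∀ u, |mu u| ≤ n + 1) ∧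
      (∀ g : ℕ → ℝ, (∀ p, 0 ≤ g p) → (∀ p, g p ≤ 1) →
        ∏ p ∈ (range n).biUnion Q, (1 - g p) ≤
          ∑ u ∈ ((range n).biUnion Q).powerset, lam u * ∏ p ∈ u, g p ∧
        ∑ u ∈ ((range n).biUnion Q).powerset, mu u * ∏ p ∈ u, g p ≤
          ∏ p ∈ (range n).biUnion Q, (1 - g p) ∧
        ∀ ε : ℕ → ℝ, (∀ i < n, ∑ u ∈ (Q i).powerset with #u = c i, ∏ p ∈ u, g p ≤
            ε i * ∏ p ∈ Q i, (1 - g p)) → (∀ i, 0 ≤ ε i) →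
          (1 - ∑ i ∈ range n, ε i) *
              ∑ u ∈ ((range n).biUnion Q).powerset, lam u * ∏ p ∈ u, g p ≤
            ∑ u ∈ ((range n).biUnion Q).powerset, mu u * ∏ p ∈ u, g p) := by
  induction n with
  | zero =>
    refine ⟨fun _ => 1, fun _ => 1, ?_, ?_, by simp, by simp, ?_⟩
    · intro u hu _
      simp at hu
      simp [hu]
    · intro u hu _
      simp at hu
      simp [hu]
    · intro g _ _
      simp
  | succ n ih =>
    obtain ⟨lam, mu, hl, hm, hlb, hmb, hmain⟩ := ih
    set P := (range n).biUnion Q with hP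
    have hPn : (range (n + 1)).biUnion Q = P ∪ Q n := by
      rw [Finset.range_add_one, Finset.biUnion_insert, Finset.union_comm]
    have hdisj : Disjoint P (Q n) := by
      rw [hP, Finset.disjoint_biUnion_left]
      intro i hi
      exact hQ i n (Finset.mem_range.1 hi).ne
    have hsplit : ∀ u ⊆ P ∪ Q n, ∀ f : ℕ → ℝ,
        ∏ p ∈ u, f p = (∏ p ∈ u ∩ P, f p) * ∏ p ∈ u ∩ Q n, f p := by
      intro u hu f
      rw [← Finset.prod_union (hdisj.mono Finset.inter_subset_right Finset.inter_subset_right),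
        ← Finset.inter_union_distrib_left, Finset.inter_eq_left.2 hu]
    have hsplit' : ∀ u ⊆ P ∪ Q n, ∏ p ∈ u, p = (∏ p ∈ u ∩ P, p) * ∏ p ∈ u ∩ Q n, p := by
      intro u hu
      rw [← Finset.prod_union (hdisj.mono Finset.inter_subset_right Finset.inter_subset_right),
        ← Finset.inter_union_distrib_left, Finset.inter_eq_left.2 hu]
    have hQb : ∀ v ⊆ Q n, #v ≤ c n → ∏ p ∈ v, p ≤ Y n ^ c n := by
      intro v hv hcard
      calc ∏ p ∈ v, p ≤ Y n ^ #v := Finset.prod_le_pow_card v _ _ fun p hp => hY n p (hv hp)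
        _ ≤ _ := Nat.pow_le_pow_right (hY1 n) hcard
    set B := truncatedMoebius (c n) with hB
    set B' := truncatedMoebius (c n + 1) with hB'
    have hBsupp : ∀ v, B v ≠ 0 → #v ≤ c n := by
      intro v hv
      by_contra hcon
      exact hv (by rw [hB, truncatedMoebius, if_neg (by omega)])
    have hB'supp : ∀ v, B' v ≠ 0 → #v ≤ c n := by
      intro v hv
      by_contra hcon
      exact hv (by rw [hB', truncatedMoebius, if_neg (by omega)])
    have hBB : ∀ v, |B' v - B v| ≤ 1 := by
      intro v
      rw [hB, hB', truncatedMoebius, truncatedMoebius]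
      split_ifs <;> first | omega | simp
    refine ⟨fun u => lam (u ∩ P) * B (u ∩ Q n),
      fun u => mu (u ∩ P) * B (u ∩ Q n) + lam (u ∩ P) * (B' (u ∩ Q n) - B (u ∩ Q n)),
      ?_, ?_, ?_, ?_, ?_⟩
    · rw [hPn]
      intro u hu hne
      rw [hsplit' u hu, Finset.prod_range_succ]
      exact Nat.mul_le_mul (hl _ Finset.inter_subset_right (left_ne_zero_of_mul hne))
        (hQb _ Finset.inter_subset_right (hBsupp _ (right_ne_zero_of_mul hne)))
    · rw [hPn]
      intro u hu hne
      rw [hsplit' u hu, Finset.prod_range_succ]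
      have h1 : mu (u ∩ P) ≠ 0 ∨ lam (u ∩ P) ≠ 0 := by
        by_contra hcon
        push Not at hcon
        exact hne (by simp only [hcon.1, hcon.2]; ring)
      have h2 : B (u ∩ Q n) ≠ 0 ∨ B' (u ∩ Q n) ≠ 0 := by
        by_contra hcon
        push Not at hcon
        exact hne (by simp only [hcon.1, hcon.2]; ring)
      refine Nat.mul_le_mul ?_ (hQb _ Finset.inter_subset_right ?_)
      · rcases h1 with h | h
        · exact hm _ Finset.inter_subset_right h
        · exact hl _ Finset.inter_subset_right h
      · rcases h2 with h | h
        · exact hBsupp _ h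
        · exact hB'supp _ h
    · intro u
      simp only
      rw [abs_mul]
      exact mul_le_one₀ (hlb _) (abs_nonneg _) (abs_truncatedMoebius_le _ _)
    · intro u
      simp only
      refine (abs_add_le _ _).trans ?_
      rw [abs_mul, abs_mul]
      have h1 : |mu (u ∩ P)| * |B (u ∩ Q n)| ≤ (n + 1) * 1 :=
        mul_le_mul (hmb _) (abs_truncatedMoebius_le _ _) (abs_nonneg _) (by positivity)
      have h2 : |lam (u ∩ P)| * |B' (u ∩ Q n) - B (u ∩ Q n)| ≤ 1 * 1 :=
        mul_le_mul (hlb _) (hBB _) (abs_nonneg _) zero_le_one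
      push_cast
      linarith
    · rw [hPn]
      intro g hg0 hg1
      obtain ⟨hA, hC, hE⟩ := hmain g hg0 hg1
      set L := ∑ u ∈ P.powerset, lam u * ∏ p ∈ u, g p with hL
      set M := ∑ u ∈ P.powerset, mu u * ∏ p ∈ u, g p with hM
      set E := ∑ u ∈ (Q n).powerset, B u * ∏ p ∈ u, g p with hEdef
      set E' := ∑ u ∈ (Q n).powerset, B' u * ∏ p ∈ u, g p with hE'def
      have hsum : ∀ F G : Finset ℕ → ℝ,
          ∑ u ∈ (P ∪ Q n).powerset, F (u ∩ P) * G (u ∩ Q n) * ∏ p ∈ u, g p =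
          (∑ u ∈ P.powerset, F u * ∏ p ∈ u, g p) *
            ∑ u ∈ (Q n).powerset, G u * ∏ p ∈ u, g p := by
        intro F G
        rw [← sum_powerset_union_mul hdisj]
        refine Finset.sum_congr rfl fun u hu => ?_
        rw [hsplit u (Finset.mem_powerset.1 hu)]
        ring
      have hlamsum : ∑ u ∈ (P ∪ Q n).powerset, lam (u ∩ P) * B (u ∩ Q n) * ∏ p ∈ u, g p =
          L * E := hsum lam B
      have hmusum : ∑ u ∈ (P ∪ Q n).powerset, (mu (u ∩ P) * B (u ∩ Q n) +
          lam (u ∩ P) * (B' (u ∩ Q n) - B (u ∩ Q n))) * ∏ p ∈ u, g p =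
          M * E + L * (E' - E) := by
        have h1 := hsum mu B
        have h2 := hsum lam B'
        rw [mul_sub, ← h1, ← h2, ← hlamsum, ← Finset.sum_sub_distrib, ← Finset.sum_add_distrib]
        exact Finset.sum_congr rfl fun u _ => by ring
      have hVP : 0 ≤ ∏ p ∈ P, (1 - g p) :=
        Finset.prod_nonneg fun p _ => sub_nonneg.2 (hg1 p)
      have hVQ : 0 ≤ ∏ p ∈ Q n, (1 - g p) :=
        Finset.prod_nonneg fun p _ => sub_nonneg.2 (hg1 p)
      have hbon := (bonferroni (Q n) g (fun p _ => hg0 p) (fun p _ => hg1 p) (c n)).1 (hc n)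
      have hbon' := (bonferroni (Q n) g (fun p _ => hg0 p) (fun p _ => hg1 p) (c n + 1)).2
        (hc n).add_one
      have hEE := sum_truncatedMoebius_succ (Q n) g (hc n)
      rw [← hB, ← hEdef] at hbon
      rw [← hB', ← hE'def] at hbon'
      rw [← hB', ← hE'def, ← hB, ← hEdef] at hEE
      simp only
      rw [hlamsum, hmusum, Finset.prod_union hdisj]
      have hL0 : 0 ≤ L := hVP.trans hA
      have hE0 : 0 ≤ E := hVQ.trans hbon
      refine ⟨mul_le_mul hA hbon hVQ hL0, ?_, ?_⟩
      · have h1 := mul_le_mul_of_nonneg_right hC hE0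
        have h2 : L * (E' - E) ≤ (∏ p ∈ P, (1 - g p)) * (E' - E) :=
          mul_le_mul_of_nonpos_right hA (by linarith)
        have h3 := mul_le_mul_of_nonneg_left hbon' hVP
        linarith
      · intro ε hε hε0
        have h1 := hE ε (fun i hi => hε i (by omega)) hε0
        have h2 := hε n (by omega)
        have h3 : E - E' ≤ ε n * E := by
          have := mul_le_mul_of_nonneg_left hbon (hε0 n)
          linarith
        rw [Finset.sum_range_succ]
        have h4 := mul_le_mul_of_nonneg_right h1 hE0
        have h5 := mul_le_mul_of_nonneg_left h3 hL0
        linarith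

/-- The primes `p ≤ z` with `p ≡ 1 (mod 4)`. -/
def splitPrimes (z : ℕ) : Finset ℕ := (range (z + 1)).filter fun p => p.Prime ∧ p % 4 = 1

theorem mem_splitPrimes {z p : ℕ} : p ∈ splitPrimes z ↔ p ≤ z ∧ p.Prime ∧ p % 4 = 1 := by
  rw [splitPrimes, Finset.mem_filter, Finset.mem_range, Nat.lt_succ_iff]

theorem five_le_of_mem_splitPrimes {z p : ℕ} (hp : p ∈ splitPrimes z) : 5 ≤ p := by
  obtain ⟨_, h1, h2⟩ := mem_splitPrimes.1 hp
  have := h1.two_le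
  omega

/-- The primes `p ≡ 1 (mod 4)` in `(2 ^ 2 ^ i, 2 ^ 2 ^ (i + 1)]`. -/
def splitPrimesBlock (i : ℕ) : Finset ℕ :=
  (splitPrimes (2 ^ 2 ^ (i + 1))).filter fun p => 2 ^ 2 ^ i < p

theorem two_pow_two_pow_mono {i j : ℕ} (h : i ≤ j) : 2 ^ 2 ^ i ≤ 2 ^ 2 ^ j :=
  Nat.pow_le_pow_right (by norm_num) (Nat.pow_le_pow_right (by norm_num) h)

theorem disjoint_splitPrimesBlock {i j : ℕ} (h : i ≠ j) :
    Disjoint (splitPrimesBlock i) (splitPrimesBlock j) := by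
  rw [Finset.disjoint_left]
  intro p hi hj
  rw [splitPrimesBlock, Finset.mem_filter, mem_splitPrimes] at hi hj
  rcases lt_or_gt_of_ne h with h | h
  · have := two_pow_two_pow_mono (Nat.succ_le_of_lt h)
    simp only [Nat.succ_eq_add_one] at this
    omega
  · have := two_pow_two_pow_mono (Nat.succ_le_of_lt h)
    simp only [Nat.succ_eq_add_one] at this
    omega

theorem biUnion_splitPrimesBlock (n : ℕ) :
    (range n).biUnion splitPrimesBlock = splitPrimes (2 ^ 2 ^ n) := by
  induction n with
  | zero =>
    ext p
    simp only [Finset.range_zero, Finset.biUnion_empty, Finset.notMem_empty, false_iff]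
    intro hp
    have h1 := five_le_of_mem_splitPrimes hp
    have h2 := (mem_splitPrimes.1 hp).1
    norm_num at h2
    omega
  | succ n ih =>
    rw [Finset.range_add_one, Finset.biUnion_insert, ih]
    ext p
    have := two_pow_two_pow_mono (Nat.le_succ n)
    simp only [Nat.succ_eq_add_one] at this
    rw [Finset.mem_union, splitPrimesBlock, Finset.mem_filter, mem_splitPrimes, mem_splitPrimes]
    constructor
    · rintro (h | h)
      · exact h.1
      · exact ⟨h.1.trans this, h.2⟩
    · intro h
      by_cases hp : 2 ^ 2 ^ n < p
      · exact Or.inl ⟨h, hp⟩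
      · exact Or.inr ⟨not_lt.1 hp, h.2⟩

theorem sum_inv_splitPrimesBlock_le (i : ℕ) : ∑ p ∈ splitPrimesBlock i, 1 / (p : ℝ) ≤ 4 := by
  have hlog2 : 0 < Real.log 2 := Real.log_pos (by norm_num)
  have h1 : (2 ^ i * Real.log 2) * ∑ p ∈ splitPrimesBlock i, 1 / (p : ℝ) ≤
      ∑ p ∈ splitPrimesBlock i, Real.log p / p := by
    rw [Finset.mul_sum]
    refine Finset.sum_le_sum fun p hp => ?_
    rw [splitPrimesBlock, Finset.mem_filter] at hp
    rw [mul_one_div]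
    refine div_le_div_of_nonneg_right ?_ (Nat.cast_nonneg p)
    calc (2 : ℝ) ^ i * Real.log 2 = Real.log (((2 ^ 2 ^ i : ℕ) : ℝ)) := by
          push_cast; rw [Real.log_pow]; push_cast; rfl
      _ ≤ _ := Real.log_le_log (by positivity) (by exact_mod_cast hp.2.le)
  have h2 : ∑ p ∈ splitPrimesBlock i, Real.log p / p ≤ 2 * Real.log ((2 ^ 2 ^ (i + 1) : ℕ) : ℝ) := by
    refine le_trans (Finset.sum_le_sum_of_subset_of_nonneg ?_ fun p _ _ =>
      div_nonneg (Real.log_natCast_nonneg p) (Nat.cast_nonneg p)) (sum_log_div_prime_le _)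
    intro p hp
    rw [splitPrimesBlock, Finset.mem_filter, mem_splitPrimes] at hp
    rw [Finset.mem_filter, Finset.mem_range]
    exact ⟨Nat.lt_succ_of_le hp.1.1, hp.1.2.1⟩
  have h3 : 2 * Real.log ((2 ^ 2 ^ (i + 1) : ℕ) : ℝ) = (2 ^ i * Real.log 2) * 4 := by
    push_cast
    rw [Real.log_pow]
    push_cast
    ring
  rw [h3] at h2
  exact le_of_mul_le_mul_left (h1.trans h2) (by positivity)

theorem exp_neg_two_mul_le {x : ℝ} (h0 : 0 ≤ x) (h1 : x ≤ 1 / 2) :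
    Real.exp (-(2 * x)) ≤ 1 - x := by
  rw [Real.exp_neg]
  have h2 : 1 + 2 * x ≤ Real.exp (2 * x) := by linarith [Real.add_one_le_exp (2 * x)]
  refine (inv_anti₀ (by linarith) h2).trans ?_
  rw [inv_le_comm₀ (by linarith) (by linarith), inv_eq_one_div, div_le_iff₀ (by linarith)]
  nlinarith

theorem exists_pow_div_factorial_le :
    ∃ B : ℕ, ∀ c ≥ B, (8 : ℝ) ^ c / c.factorial ≤ (1 / 2 * (1 / 2) ^ c) * Real.exp (-16) := by
  have h := FloorSemiring.tendsto_pow_div_factorial_atTop (K := ℝ) 16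
  have h2 := h.eventually (gt_mem_nhds (show (0 : ℝ) < 1 / 2 * Real.exp (-16) by positivity))
  obtain ⟨B, hB⟩ := Filter.eventually_atTop.1 h2
  refine ⟨B, fun c hc => ?_⟩
  have h3 := (hB c hc).le
  have h4 : (16 : ℝ) ^ c = 8 ^ c * 2 ^ c := by rw [← mul_pow]; norm_num
  rw [h4] at h3
  have h5 : (0 : ℝ) < 2 ^ c := by positivity
  have h6 : (1 / 2 : ℝ) ^ c = 1 / 2 ^ c := by rw [div_pow, one_pow]
  rw [h6]
  calc (8 : ℝ) ^ c / c.factorial = (8 ^ c * 2 ^ c / c.factorial) * (1 / 2 ^ c) := by field_simp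
    _ ≤ (1 / 2 * Real.exp (-16)) * (1 / 2 ^ c) := mul_le_mul_of_nonneg_right h3 (by positivity)
    _ = _ := by ring

theorem sum_exponents_add_le (B n : ℕ) :
    ∑ i ∈ range n, 2 ^ (i + 1) * (2 * (B + (n - i)) + 1) + 4 * n + (4 * B + 10) ≤
      2 ^ n * (4 * B + 10) := by
  induction n with
  | zero => simp
  | succ n ih =>
    rw [Finset.sum_range_succ']
    have h : ∑ i ∈ range n, 2 ^ (i + 1 + 1) * (2 * (B + (n + 1 - (i + 1))) + 1) =
        2 * ∑ i ∈ range n, 2 ^ (i + 1) * (2 * (B + (n - i)) + 1) := by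
      rw [Finset.mul_sum]
      refine Finset.sum_congr rfl fun i _ => ?_
      rw [Nat.add_sub_add_right, pow_succ 2 (i + 1)]
      ring
    rw [h, pow_succ 2 n]
    simp only [Nat.sub_zero, zero_add, pow_one]
    nlinarith

theorem card_le_of_prod_le {P : Finset ℕ} (hP : ∀ p ∈ P, p.Prime) (D : ℕ)
    (U : Finset (Finset ℕ)) (hU : ∀ u ∈ U, u ⊆ P ∧ ∏ p ∈ u, p ≤ D) : #U ≤ D := by
  calc #U ≤ #(Finset.Icc 1 D) := by
        refine Finset.card_le_card_of_injOn (fun u => ∏ p ∈ u, p) ?_ ?_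
        · intro u hu
          rw [Finset.mem_coe, Finset.mem_Icc]
          exact ⟨Finset.prod_pos fun p hp => (hP p ((hU u hu).1 hp)).pos, (hU u hu).2⟩
        · intro u hu v hv huv
          have h := congrArg Nat.primeFactors huv
          simp only at h
          rwa [Nat.primeFactors_prod fun p hp => hP p ((hU u hu).1 hp),
            Nat.primeFactors_prod fun p hp => hP p ((hU v hv).1 hp)] at h
    _ = D := by simp

/-- A lower-bound sieve of dimension one over the primes `≡ 1 (mod 4)`. -/
theorem exists_sieve_lower_bound :
    ∃ C : ℕ, ∀ (n : ℕ) (g : ℕ → ℝ), (∀ p, 0 ≤ g p) → (∀ p, g p ≤ 1) →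
      (∀ p ∈ splitPrimes (2 ^ 2 ^ n), g p ≤ 2 / p) →
      ∀ {ι : Type} (s : Finset ι) (cond : ℕ → ι → Prop) (X R : ℝ), 0 ≤ X → 0 ≤ R →
      (∀ u ⊆ splitPrimes (2 ^ 2 ^ n), ∏ p ∈ u, p ≤ (2 ^ 2 ^ n) ^ C →
        |(#(s.filter fun i => ∀ p ∈ u, cond p i) : ℝ) - X * ∏ p ∈ u, g p| ≤ R) →
      X / 2 * ∏ p ∈ splitPrimes (2 ^ 2 ^ n), (1 - g p) -
          (n + 1) * ((2 ^ 2 ^ n) ^ C : ℕ) * R ≤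
        #(s.filter fun i => ∀ p ∈ splitPrimes (2 ^ 2 ^ n), ¬ cond p i) := by
  obtain ⟨B, hB⟩ := exists_pow_div_factorial_le
  refine ⟨4 * B + 10, ?_⟩
  intro n g hg0 hg1 hg2 ι s cond X R hX hR happrox
  set P := splitPrimes (2 ^ 2 ^ n) with hP
  set c : ℕ → ℕ := fun i => 2 * (B + (n - i)) + 1 with hc
  set D : ℕ := (2 ^ 2 ^ n) ^ (4 * B + 10) with hD
  obtain ⟨lam, mu, -, hm, -, hmb, hmain⟩ := exists_sieve_weights splitPrimesBlock
    (fun i j h => disjoint_splitPrimesBlock h) c (fun i => 2 ^ 2 ^ (i + 1))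
    (fun i => ⟨B + (n - i), rfl⟩)
    (fun i p hp => (mem_splitPrimes.1 (Finset.mem_filter.1 hp).1).1)
    (fun i => Nat.one_le_two_pow) n
  rw [biUnion_splitPrimesBlock, ← hP] at hm hmain
  have hDle : ∏ i ∈ range n, (2 ^ 2 ^ (i + 1)) ^ c i ≤ D := by
    have h1 : ∏ i ∈ range n, (2 ^ 2 ^ (i + 1)) ^ c i =
        2 ^ ∑ i ∈ range n, 2 ^ (i + 1) * c i := by
      rw [← Finset.prod_pow_eq_pow_sum]
      exact Finset.prod_congr rfl fun i _ => by rw [pow_mul]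
    rw [h1, hD, ← pow_mul]
    refine Nat.pow_le_pow_right (by norm_num) ?_
    have := sum_exponents_add_le B n
    simp only [hc]
    omega
  have hmD : ∀ u ⊆ P, mu u ≠ 0 → ∏ p ∈ u, p ≤ D := fun u hu h => (hm u hu h).trans hDle
  -- the model sum
  set ε : ℕ → ℝ := fun i => 1 / 2 * (1 / 2) ^ c i with hε
  have hblock : ∀ i < n, ∑ u ∈ (splitPrimesBlock i).powerset with #u = c i, ∏ p ∈ u, g p ≤
      ε i * ∏ p ∈ splitPrimesBlock i, (1 - g p) := by
    intro i hi
    have hsub : ∀ p ∈ splitPrimesBlock i, p ∈ P := by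
      intro p hp
      rw [hP, ← biUnion_splitPrimesBlock]
      exact Finset.mem_biUnion.2 ⟨i, Finset.mem_range.2 hi, hp⟩
    have hsum8 : ∑ p ∈ splitPrimesBlock i, g p ≤ 8 := by
      calc ∑ p ∈ splitPrimesBlock i, g p ≤ ∑ p ∈ splitPrimesBlock i, 2 * (1 / (p : ℝ)) :=
            Finset.sum_le_sum fun p hp => (hg2 p (hsub p hp)).trans (le_of_eq (by ring))
        _ = 2 * ∑ p ∈ splitPrimesBlock i, 1 / (p : ℝ) := by rw [Finset.mul_sum]
        _ ≤ 8 := by linarith [sum_inv_splitPrimesBlock_le i]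
    have hprod : Real.exp (-16) ≤ ∏ p ∈ splitPrimesBlock i, (1 - g p) := by
      calc Real.exp (-16) ≤ Real.exp (∑ p ∈ splitPrimesBlock i, -(2 * g p)) := by
            rw [Real.exp_le_exp, Finset.sum_neg_distrib, ← Finset.mul_sum]
            linarith
        _ = ∏ p ∈ splitPrimesBlock i, Real.exp (-(2 * g p)) := Real.exp_sum _ _
        _ ≤ _ := by
            refine Finset.prod_le_prod (fun p _ => (Real.exp_pos _).le) fun p hp => ?_
            refine exp_neg_two_mul_le (hg0 p) ((hg2 p (hsub p hp)).trans ?_)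
            have h5 : (5 : ℝ) ≤ p := by exact_mod_cast five_le_of_mem_splitPrimes (hsub p hp)
            rw [div_le_div_iff₀ (by linarith) (by norm_num)]
            linarith
    have hεi : 0 ≤ ε i := by rw [hε]; positivity
    calc _ ≤ (∑ p ∈ splitPrimesBlock i, g p) ^ c i / (c i).factorial :=
          sum_powersetCard_prod_le _ g (fun p _ => hg0 p) _
      _ ≤ 8 ^ c i / (c i).factorial := by
          gcongr
          exact Finset.sum_nonneg fun p _ => hg0 p
      _ ≤ ε i * Real.exp (-16) := hB _ (by rw [hc]; simp only; omega)
      _ ≤ _ := mul_le_mul_of_nonneg_left hprod hεi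
  have hεsum : ∑ i ∈ range n, ε i ≤ 1 / 2 := by
    have h1 : ∀ i ∈ range n, ε i ≤ 1 / 2 * (1 / 2) ^ (n - 1 - i + 1) := by
      intro i hi
      have := Finset.mem_range.1 hi
      rw [hε]
      simp only
      refine mul_le_mul_of_nonneg_left ?_ (by norm_num)
      exact pow_le_pow_of_le_one (by norm_num) (by norm_num) (by rw [hc]; simp only; omega)
    refine (Finset.sum_le_sum h1).trans ?_
    rw [Finset.sum_range_reflect (fun j => (1 / 2 : ℝ) * (1 / 2) ^ (j + 1)) n]
    have h2 : ∀ n : ℕ, ∑ j ∈ range n, (1 / 2 : ℝ) * (1 / 2) ^ (j + 1) =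
        1 / 2 * (1 - (1 / 2) ^ n) := by
      intro n
      induction n with
      | zero => simp
      | succ n ih => rw [Finset.sum_range_succ, ih]; ring
    rw [h2]
    have : (0 : ℝ) ≤ (1 / 2) ^ n := by positivity
    linarith
  obtain ⟨hA, -, hE⟩ := hmain g hg0 hg1
  have hE := hE ε hblock (fun i => by rw [hε]; positivity)
  have hV : 0 ≤ ∏ p ∈ P, (1 - g p) := Finset.prod_nonneg fun p _ => sub_nonneg.2 (hg1 p)
  have hmodel : 1 / 2 * ∏ p ∈ P, (1 - g p) ≤ ∑ u ∈ P.powerset, mu u * ∏ p ∈ u, g p := by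
    refine le_trans ?_ hE
    exact mul_le_mul (by linarith) hA hV (by linarith)
  -- the count
  set N : Finset ℕ → ℝ := fun u => #(s.filter fun i => ∀ p ∈ u, cond p i) with hN
  have hcount : ∑ u ∈ P.powerset, mu u * N u ≤ #(s.filter fun i => ∀ p ∈ P, ¬ cond p i) := by
    have h1 : ∑ u ∈ P.powerset, mu u * N u =
        ∑ i ∈ s, ∑ u ∈ P.powerset, mu u * ∏ p ∈ u, if cond p i then (1 : ℝ) else 0 := by
      rw [Finset.sum_comm]
      refine Finset.sum_congr rfl fun u _ => ?_
      rw [← Finset.mul_sum]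
      congr 1
      rw [hN]
      simp only [Finset.prod_boole]
      rw [Finset.sum_boole]
    rw [h1, ← Finset.sum_boole]
    refine Finset.sum_le_sum fun i _ => ?_
    obtain ⟨-, h2, -⟩ := hmain (fun p => if cond p i then (1 : ℝ) else 0)
      (fun p => by split_ifs <;> norm_num) (fun p => by split_ifs <;> norm_num)
    refine h2.trans (le_of_eq ?_)
    rw [← Finset.prod_boole]
    refine Finset.prod_congr rfl fun p _ => ?_
    by_cases h : cond p i <;> simp [h]
  have herr : ∑ u ∈ P.powerset, mu u * (X * ∏ p ∈ u, g p) - (n + 1) * D * R ≤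
      ∑ u ∈ P.powerset, mu u * N u := by
    have h1 : ∑ u ∈ P.powerset, (mu u * (X * ∏ p ∈ u, g p) - mu u * N u) ≤
        ∑ u ∈ P.powerset with mu u ≠ 0, (n + 1 : ℝ) * R := by
      rw [Finset.sum_filter]
      refine Finset.sum_le_sum fun u hu => ?_
      rw [Finset.mem_powerset] at hu
      split_ifs with h
      · have h2 := happrox u hu (hmD u hu h)
        rw [← mul_sub]
        refine (le_abs_self _).trans ?_
        rw [abs_mul, abs_sub_comm]
        exact mul_le_mul (hmb u) h2 (abs_nonneg _) (by positivity)
      · rw [not_not.1 h]; simp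
    have hcard : #(P.powerset.filter fun u => mu u ≠ 0) ≤ D := by
      refine card_le_of_prod_le (P := P) (fun p hp => (mem_splitPrimes.1 hp).2.1) D _ ?_
      intro u hu
      rw [Finset.mem_filter, Finset.mem_powerset] at hu
      exact ⟨hu.1, hmD u hu.1 hu.2⟩
    rw [Finset.sum_sub_distrib, Finset.sum_const, nsmul_eq_mul] at h1
    have h2 : (#(P.powerset.filter fun u => mu u ≠ 0) : ℝ) * ((n + 1) * R) ≤
        D * ((n + 1) * R) :=
      mul_le_mul_of_nonneg_right (by exact_mod_cast hcard) (by positivity)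
    linarith
  have hfac : ∑ u ∈ P.powerset, mu u * (X * ∏ p ∈ u, g p) =
      X * ∑ u ∈ P.powerset, mu u * ∏ p ∈ u, g p := by
    rw [Finset.mul_sum]
    exact Finset.sum_congr rfl fun u _ => by ring
  have hfin := mul_le_mul_of_nonneg_left hmodel hX
  have e : X / 2 * ∏ p ∈ P, (1 - g p) = X * (1 / 2 * ∏ p ∈ P, (1 - g p)) := by ring
  rw [e]
  refine le_trans ?_ ((herr.trans hcount).trans (le_of_eq (by congr!)))
  rw [hfac]
  exact sub_le_sub_right hfin _

theorem exists_eq_sq_add_sq {n : ℕ} (hn : ∀ p : ℕ, p.Prime → p ∣ n → p % 4 = 1) :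
    ∃ x y : ℕ, n = x ^ 2 + y ^ 2 := by
  refine Nat.eq_sq_add_sq_iff.2 fun q hq hq3 => ?_
  have := hn q (Nat.prime_of_mem_primeFactors hq) (Nat.dvd_of_mem_primeFactors hq)
  omega

theorem coprime_of_mod_four {m k : ℕ} (hm : ∀ p : ℕ, p.Prime → p ∣ m → p % 4 = 1)
    (hk : ∀ p : ℕ, p.Prime → p ∣ k → p % 4 = 3) : m.Coprime k := by
  refine Nat.coprime_of_dvd fun p hp h1 h2 => ?_
  have := hm p hp h1
  have := hk p hp h2
  omega

theorem isUnit_sq_add_sq {k : ℕ} [NeZero k] (hk : ∀ p : ℕ, p.Prime → p ∣ k → p % 4 = 3)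
    {x : ZMod k} (hx : IsUnit x) (y : ZMod k) : IsUnit (x ^ 2 + y ^ 2) := by
  have hxv : x.val.Coprime k := (ZMod.isUnit_iff_coprime x.val k).1 (by simpa using hx)
  have h : IsUnit ((x.val ^ 2 + y.val ^ 2 : ℕ) : ZMod k) := by
    refine (ZMod.isUnit_iff_coprime _ k).2 (Nat.coprime_of_dvd fun p hp h1 h2 => ?_)
    have : Fact p.Prime := ⟨hp⟩
    have h3 : ((x.val : ZMod p)) ≠ 0 := fun h4 =>
      hp.one_lt.ne' (Nat.dvd_one.1 (hxv ▸ Nat.dvd_gcd ((ZMod.natCast_eq_zero_iff _ _).1 h4) h2))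
    refine ZMod.mod_four_ne_three_of_sq_eq_neg_sq (p := p) (y := (y.val : ZMod p)) h3 ?_
      (hk p hp h2)
    have h4 := (ZMod.natCast_eq_zero_iff _ _).2 h1
    push_cast at h4
    exact eq_neg_of_add_eq_zero_left h4
  simpa using h

/-- Invertible values of the norm form are all taken equally often. -/
theorem card_sq_add_sq_le {R : Type} [CommRing R] [Fintype R] [DecidableEq R] {s t : R} (hs : IsUnit s)
    (ht : IsUnit t) (hsx : ∃ a c, a ^ 2 + c ^ 2 = s) :
    #((Finset.univ : Finset (R × R)).filter fun r => r.1 ^ 2 + r.2 ^ 2 = t) ≤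
      #((Finset.univ : Finset (R × R)).filter fun r => r.1 ^ 2 + r.2 ^ 2 = s) := by
  obtain ⟨a, c, hac⟩ := hsx
  by_cases hne : ∃ x y, x ^ 2 + y ^ 2 = t
  · obtain ⟨x, y, hxy⟩ := hne
    obtain ⟨t', ht'⟩ := ht.exists_right_inv
    set e := (a * x - c * y) * t' with he
    set f := (a * y + c * x) * t' with hf
    have hef : (e ^ 2 + f ^ 2) * t = s := by
      have h1 : e ^ 2 + f ^ 2 = (a ^ 2 + c ^ 2) * (x ^ 2 + y ^ 2) * t' ^ 2 := by
        rw [he, hf]; ring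
      rw [h1, hac, hxy]
      linear_combination (s * (t * t' + 1)) * ht'
    have hu : IsUnit (e ^ 2 + f ^ 2) := isUnit_of_mul_isUnit_left (hef ▸ hs)
    refine Finset.card_le_card_of_injOn
      (fun r => (e * r.1 - f * r.2, e * r.2 + f * r.1)) ?_ ?_
    · intro r hr
      simp only [Finset.coe_filter, Finset.mem_univ, true_and, Set.mem_ofPred_eq] at hr ⊢
      rw [← hef, ← hr]
      ring
    · intro r _ r' _ h
      simp only [Prod.mk.injEq] at h
      refine Prod.ext (hu.mul_left_cancel ?_) (hu.mul_left_cancel ?_)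
      · linear_combination e * h.1 + f * h.2
      · linear_combination e * h.2 - f * h.1
  · push Not at hne
    rw [Finset.filter_false_of_mem fun r _ => hne r.1 r.2]
    simp

theorem le_card_sq_add_sq {k : ℕ} [NeZero k] (hk : ∀ p : ℕ, p.Prime → p ∣ k → p % 4 = 3)
    {s : ZMod k} (hs : IsUnit s) (hsx : ∃ a c, a ^ 2 + c ^ 2 = s) :
    k ≤ #((Finset.univ : Finset (ZMod k × ZMod k)).filter fun r => r.1 ^ 2 + r.2 ^ 2 = s) := by
  set F := #((Finset.univ : Finset (ZMod k × ZMod k)).filter fun r => r.1 ^ 2 + r.2 ^ 2 = s)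
  set U : Finset (ZMod k) := Finset.univ.filter IsUnit
  have hU : 0 < #U := Finset.card_pos.2 ⟨1, by simp [U]⟩
  have h1 : #(U ×ˢ (Finset.univ : Finset (ZMod k))) ≤ F * #U := by
    refine Finset.card_le_mul_card_image_of_maps_to (f := fun r => r.1 ^ 2 + r.2 ^ 2) ?_ F ?_
    · intro r hr
      rw [Finset.mem_product] at hr
      simp only [U, Finset.mem_filter, Finset.mem_univ, true_and] at hr ⊢
      exact isUnit_sq_add_sq hk hr.1 _
    · intro t ht
      refine le_trans (Finset.card_le_card ?_)
        (card_sq_add_sq_le hs (Finset.mem_filter.1 ht).2 hsx)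
      exact Finset.filter_subset_filter _ (Finset.subset_univ _)
  rw [Finset.card_product, Finset.card_univ, ZMod.card, mul_comm] at h1
  exact Nat.le_of_mul_le_mul_right h1 hU

/-- At least `k` residue classes of pairs modulo `k` satisfy `s (x² + y²) ≡ m`. -/
theorem le_card_residue_pairs {m k s : ℕ} (hk0 : 0 < k)
    (hk : ∀ p : ℕ, p.Prime → p ∣ k → p % 4 = 3)
    (hm : ∀ p : ℕ, p.Prime → p ∣ m → p % 4 = 1) (hs : ∀ p : ℕ, p.Prime → p ∣ s → p % 4 = 1) :
    k ≤ #((range k ×ˢ range k).filter fun r => s * (r.1 ^ 2 + r.2 ^ 2) ≡ m [MOD k]) := by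
  have : NeZero k := ⟨hk0.ne'⟩
  have hmu : IsUnit (m : ZMod k) := (ZMod.isUnit_iff_coprime _ _).2 (coprime_of_mod_four hm hk)
  have hsu : IsUnit (s : ZMod k) := (ZMod.isUnit_iff_coprime _ _).2 (coprime_of_mod_four hs hk)
  obtain ⟨t, ht⟩ := hsu.exists_right_inv
  have htu : IsUnit t := IsUnit.of_mul_eq_one _ (by rw [mul_comm]; exact ht)
  obtain ⟨a, c, hac⟩ := exists_eq_sq_add_sq hm
  obtain ⟨e, f, hef⟩ := exists_eq_sq_add_sq hs
  refine (le_card_sq_add_sq hk (s := m * t) (hmu.mul htu)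
    ⟨(a * e - c * f) * t, (a * f + c * e) * t, ?_⟩).trans ?_
  · have h1 : (m : ZMod k) = a ^ 2 + c ^ 2 := by rw [hac]; push_cast; ring
    have h2 : (s : ZMod k) = e ^ 2 + f ^ 2 := by rw [hef]; push_cast; ring
    rw [h1]
    rw [h2] at ht
    linear_combination ((a : ZMod k) ^ 2 + c ^ 2) * t * ht
  · refine Finset.card_le_card_of_injOn (fun r => (r.1.val, r.2.val)) ?_ ?_
    · intro r hr
      simp only [Finset.coe_filter, Finset.mem_univ, true_and, Set.mem_ofPred_eq,
        Finset.mem_product, Finset.mem_range] at hr ⊢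
      refine ⟨⟨ZMod.val_lt _, ZMod.val_lt _⟩, (ZMod.natCast_eq_natCast_iff _ _ _).1 ?_⟩
      push_cast
      rw [ZMod.natCast_zmod_val, ZMod.natCast_zmod_val, hr]
      linear_combination (m : ZMod k) * ht
    · intro r _ r' _ h
      simp only [Prod.mk.injEq] at h
      exact Prod.ext (ZMod.val_injective k h.1) (ZMod.val_injective k h.2)

/-- The number of zeros of the norm form `x² + y²` over the ring `R`. -/
noncomputable def zeroPairs (R : Type) [CommRing R] : ℕ :=
  Nat.card {r : R × R // r.1 ^ 2 + r.2 ^ 2 = 0}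

theorem zeroPairs_congr {R S : Type} [CommRing R] [CommRing S] (e : R ≃+* S) :
    zeroPairs R = zeroPairs S := by
  refine Nat.card_congr ((e.toEquiv.prodCongr e.toEquiv).subtypeEquiv fun r => ?_)
  simp only [Equiv.prodCongr_apply, Prod.map, RingEquiv.toEquiv_eq_coe, EquivLike.coe_coe]
  rw [← map_pow, ← map_pow, ← map_add, map_eq_zero_iff _ e.injective]

theorem zeroPairs_prod (R S : Type) [CommRing R] [CommRing S] :
    zeroPairs (R × S) = zeroPairs R * zeroPairs S := by
  rw [zeroPairs, zeroPairs, zeroPairs, ← Nat.card_prod]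
  refine Nat.card_congr
    { toFun := fun r => (⟨(r.1.1.1, r.1.2.1), ?_⟩, ⟨(r.1.1.2, r.1.2.2), ?_⟩)
      invFun := fun r => ⟨((r.1.1.1, r.2.1.1), (r.1.1.2, r.2.1.2)), ?_⟩
      left_inv := fun _ => rfl
      right_inv := fun _ => rfl }
  · exact congrArg Prod.fst r.2
  · exact congrArg Prod.snd r.2
  · exact Prod.ext r.1.2 r.2.2

theorem zeroPairs_zmod_one : zeroPairs (ZMod 1) = 1 := by
  rw [zeroPairs, Nat.card_eq_one_iff_unique]
  exact ⟨inferInstance, ⟨⟨(0, 0), Subsingleton.elim _ _⟩⟩⟩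

theorem zeroPairs_zmod_prod {u : Finset ℕ} (hu : ∀ p ∈ u, p.Prime) :
    zeroPairs (ZMod (∏ p ∈ u, p)) = ∏ p ∈ u, zeroPairs (ZMod p) := by
  induction u using Finset.induction_on with
  | empty => exact zeroPairs_zmod_one
  | insert q u hq ih =>
    have hcop : q.Coprime (∏ p ∈ u, p) := Nat.Coprime.prod_right fun p hp =>
      (Nat.coprime_primes (hu q (Finset.mem_insert_self _ _))
        (hu p (Finset.mem_insert_of_mem hp))).2 fun h => hq (h ▸ hp)
    rw [Finset.prod_insert hq, Finset.prod_insert hq,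
      zeroPairs_congr (ZMod.chineseRemainder hcop), zeroPairs_prod,
      ih fun p hp => hu p (Finset.mem_insert_of_mem hp)]

theorem zeroPairs_eq_card (R : Type) [CommRing R] [Fintype R] [DecidableEq R] :
    zeroPairs R = #((Finset.univ : Finset (R × R)).filter fun r => r.1 ^ 2 + r.2 ^ 2 = 0) := by
  rw [zeroPairs, Nat.card_eq_fintype_card, Fintype.card_subtype]

theorem zeroPairs_zmod_le_sq {d : ℕ} (hd : 0 < d) : zeroPairs (ZMod d) ≤ d ^ 2 := by
  have : NeZero d := ⟨hd.ne'⟩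
  rw [zeroPairs_eq_card]
  refine (Finset.card_le_univ _).trans (le_of_eq ?_)
  rw [Fintype.card_prod, ZMod.card, sq]

theorem zeroPairs_zmod_prime_le {p : ℕ} (hp : p.Prime) : zeroPairs (ZMod p) ≤ 2 * p := by
  have : Fact p.Prime := ⟨hp⟩
  rw [zeroPairs_eq_card]
  have h := Finset.card_le_mul_card_image_of_maps_to
    (s := (Finset.univ : Finset (ZMod p × ZMod p)).filter fun r => r.1 ^ 2 + r.2 ^ 2 = 0)
    (t := (Finset.univ : Finset (ZMod p))) (f := Prod.fst) (fun _ _ => Finset.mem_univ _) 2 ?_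
  · rwa [Finset.card_univ, ZMod.card] at h
  · intro x _
    by_cases hx : ∃ y, x ^ 2 + y ^ 2 = 0
    · obtain ⟨y, hy⟩ := hx
      refine (Finset.card_le_card (t := {(x, y), (x, -y)}) ?_).trans Finset.card_le_two
      intro r hr
      simp only [Finset.mem_filter, Finset.mem_univ, true_and] at hr
      simp only [Finset.mem_insert, Finset.mem_singleton]
      obtain ⟨h1, h2⟩ := hr
      rw [h2] at h1
      have h3 : r.2 ^ 2 = y ^ 2 := by linear_combination h1 - hy
      rcases sq_eq_sq_iff_eq_or_eq_neg.1 h3 with h4 | h4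
      · exact Or.inl (Prod.ext h2 h4)
      · exact Or.inr (Prod.ext h2 h4)
    · refine le_trans (le_of_eq ?_) (Nat.zero_le 2)
      rw [Finset.card_eq_zero, Finset.filter_eq_empty_iff]
      intro r hr h2
      exact hx ⟨r.2, by rw [← h2]; exact (Finset.mem_filter.1 hr).2⟩

/-- The density of the pairs whose norm is divisible by `p`. -/
noncomputable def normDensity (p : ℕ) : ℝ := zeroPairs (ZMod p) / (p : ℝ) ^ 2

theorem normDensity_nonneg (p : ℕ) : 0 ≤ normDensity p := by
  unfold normDensity; positivity

theorem normDensity_le_one (p : ℕ) : normDensity p ≤ 1 := by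
  rw [normDensity]
  rcases Nat.eq_zero_or_pos p with rfl | hp
  · simp
  · rw [div_le_one (by positivity)]
    exact_mod_cast zeroPairs_zmod_le_sq hp

theorem normDensity_prime_le {p : ℕ} (hp : p.Prime) : normDensity p ≤ 2 / p := by
  have h0 : (0 : ℝ) < p := by exact_mod_cast hp.pos
  rw [normDensity, div_le_div_iff₀ (by positivity) h0]
  have h : (zeroPairs (ZMod p) : ℝ) ≤ 2 * p := by exact_mod_cast zeroPairs_zmod_prime_le hp
  nlinarith

theorem abs_card_progression_sub_le {d k : ℕ} [NeZero d] (hdk : k.Coprime d) (h x : ℕ)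
    (w : ZMod d) :
    |(#((range h).filter fun i => ((x + k * i : ℕ) : ZMod d) = w) : ℝ) - h / d| ≤ 1 := by
  have hku : IsUnit (k : ZMod d) := (ZMod.isUnit_iff_coprime _ _).2 hdk
  obtain ⟨k', hk'⟩ := hku.exists_right_inv
  have hd : 0 < d := Nat.pos_of_ne_zero (NeZero.ne d)
  set v : ℕ := ((w - x) * k').val with hv
  have h1 : ((range h).filter fun i => ((x + k * i : ℕ) : ZMod d) = w) =
      (range h).filter fun i => i ≡ v [MOD d] := by
    refine Finset.filter_congr fun i _ => ?_
    rw [← ZMod.natCast_eq_natCast_iff, hv, ZMod.natCast_zmod_val]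
    push_cast
    constructor
    · intro h2
      linear_combination k' * h2 - (i : ZMod d) * hk'
    · intro h2
      linear_combination (k : ZMod d) * h2 + (w - x) * hk'
  rw [h1, ← Nat.count_eq_card_filter_range, Nat.count_modEq_card _ hd]
  have h2 : (h : ℝ) / d = (h / d : ℕ) + (h % d : ℕ) / d := by
    have h0 : (d : ℝ) ≠ 0 := by exact_mod_cast hd.ne'
    field_simp
    exact_mod_cast (Nat.div_add_mod h d).symm
  have h3 : ((h % d : ℕ) : ℝ) / d ≤ 1 := by
    rw [div_le_one (by exact_mod_cast hd)]
    exact_mod_cast (Nat.mod_lt h hd).le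
  have h4 : 0 ≤ ((h % d : ℕ) : ℝ) / d := by positivity
  rw [h2, abs_le]
  split_ifs <;> push_cast <;> constructor <;> linarith

theorem abs_card_norm_dvd_sub_le {d k : ℕ} (hd : 0 < d) (hdk : k.Coprime d) (h x y : ℕ) :
    |(#((range h ×ˢ range h).filter fun r => d ∣ (x + k * r.1) ^ 2 + (y + k * r.2) ^ 2) : ℝ) -
      (h : ℝ) ^ 2 * (zeroPairs (ZMod d) / (d : ℝ) ^ 2)| ≤ 2 * h * d + (d : ℝ) ^ 2 := by
  have : NeZero d := ⟨hd.ne'⟩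
  set Z := (Finset.univ : Finset (ZMod d × ZMod d)).filter fun r => r.1 ^ 2 + r.2 ^ 2 = 0 with hZ
  set A : ℕ → ZMod d → ℝ :=
    fun x w => #((range h).filter fun i => ((x + k * i : ℕ) : ZMod d) = w) with hA
  have h1 : (#((range h ×ˢ range h).filter fun r =>
      d ∣ (x + k * r.1) ^ 2 + (y + k * r.2) ^ 2) : ℝ) = ∑ w ∈ Z, A x w.1 * A y w.2 := by
    rw [Finset.card_eq_sum_card_fiberwise
      (f := fun r => (((x + k * r.1 : ℕ) : ZMod d), ((y + k * r.2 : ℕ) : ZMod d))) (t := Z)]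
    · rw [Nat.cast_sum]
      refine Finset.sum_congr rfl fun w hw => ?_
      rw [hA]
      simp only
      rw [← Nat.cast_mul, ← Finset.card_product, ← Finset.filter_product, Finset.filter_filter]
      congr 2
      ext r
      simp only [Finset.mem_filter, Prod.ext_iff]
      refine and_congr_right fun _ => ⟨fun h2 => h2.2, fun h2 => ⟨?_, h2⟩⟩
      rw [← ZMod.natCast_eq_zero_iff, ← (Finset.mem_filter.1 hw).2, ← h2.1, ← h2.2]
      push_cast
      ring
    · intro r hr
      rw [Finset.mem_coe, Finset.mem_filter] at hr
      rw [Finset.mem_coe, hZ, Finset.mem_filter]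
      refine ⟨Finset.mem_univ _, ?_⟩
      have h2 := (ZMod.natCast_eq_zero_iff _ _).2 hr.2
      push_cast at h2 ⊢
      exact h2
  have hd0 : (0 : ℝ) < d := by exact_mod_cast hd
  have hterm : ∀ w ∈ Z, |A x w.1 * A y w.2 - ((h : ℝ) / d) ^ 2| ≤ 2 * (h / d) + 1 := by
    intro w _
    have h2 := abs_card_progression_sub_le hdk h x w.1
    have h3 := abs_card_progression_sub_le hdk h y w.2
    have h4 : A x w.1 * A y w.2 - ((h : ℝ) / d) ^ 2 = (A x w.1 - h / d) * (A y w.2 - h / d) +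
        (h / d) * (A x w.1 - h / d) + (h / d) * (A y w.2 - h / d) := by ring
    have h0 : (0 : ℝ) ≤ h / d := by positivity
    rw [h4]
    refine (abs_add_three _ _ _).trans ?_
    rw [abs_mul, abs_mul, abs_mul, abs_of_nonneg h0]
    have := mul_le_mul h2 h3 (abs_nonneg _) zero_le_one
    have := mul_le_mul_of_nonneg_left h2 h0
    have := mul_le_mul_of_nonneg_left h3 h0
    simp only [hA] at *
    linarith
  have hcard : (#Z : ℝ) = zeroPairs (ZMod d) := by rw [zeroPairs_eq_card]
  have hle : (#Z : ℝ) ≤ (d : ℝ) ^ 2 := by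
    rw [hcard]; exact_mod_cast zeroPairs_zmod_le_sq hd
  have h5 : (h : ℝ) ^ 2 * (zeroPairs (ZMod d) / (d : ℝ) ^ 2) = ∑ w ∈ Z, ((h : ℝ) / d) ^ 2 := by
    rw [Finset.sum_const, nsmul_eq_mul, hcard]
    ring
  rw [h1, h5, ← Finset.sum_sub_distrib]
  calc _ ≤ ∑ w ∈ Z, |A x w.1 * A y w.2 - ((h : ℝ) / d) ^ 2| := Finset.abs_sum_le_sum_abs _ _
    _ ≤ ∑ w ∈ Z, (2 * ((h : ℝ) / d) + 1) := Finset.sum_le_sum hterm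
    _ = #Z * (2 * ((h : ℝ) / d) + 1) := by rw [Finset.sum_const, nsmul_eq_mul]
    _ ≤ (d : ℝ) ^ 2 * (2 * ((h : ℝ) / d) + 1) := by gcongr
    _ = _ := by field_simp

theorem abs_card_forall_dvd_sub_le {k : ℕ} {u : Finset ℕ} (hu : ∀ p ∈ u, p.Prime ∧ k.Coprime p)
    (h x y D : ℕ) (hD : ∏ p ∈ u, p ≤ D) (hDh : D ≤ h) :
    |(#((range h ×ˢ range h).filter fun r =>
        ∀ p ∈ u, p ∣ (x + k * r.1) ^ 2 + (y + k * r.2) ^ 2) : ℝ) -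
      (h : ℝ) ^ 2 * ∏ p ∈ u, normDensity p| ≤ 3 * h * D := by
  set d := ∏ p ∈ u, p with hd
  have hd0 : 0 < d := Finset.prod_pos fun p hp => (hu p hp).1.pos
  have h1 := abs_card_norm_dvd_sub_le hd0
    (Nat.Coprime.prod_right fun p hp => (hu p hp).2 : k.Coprime d) h x y
  have h2 : (zeroPairs (ZMod d) / (d : ℝ) ^ 2) = ∏ p ∈ u, normDensity p := by
    rw [hd, zeroPairs_zmod_prod fun p hp => (hu p hp).1]
    simp only [normDensity]
    rw [Finset.prod_div_distrib, Finset.prod_pow]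
    push_cast
    rfl
  have h3 : ∀ N : ℕ, (∀ p ∈ u, p ∣ N) ↔ d ∣ N := fun N =>
    ⟨fun h => Finset.prod_primes_dvd _ (fun p hp => (hu p hp).1.prime) h,
      fun h p hp => (Finset.dvd_prod_of_mem _ hp).trans h⟩
  simp only [h3]
  rw [← h2]
  refine h1.trans ?_
  have h4 : (d : ℝ) ≤ D := by exact_mod_cast hD
  have h5 : (D : ℝ) ≤ h := by exact_mod_cast hDh
  have h6 : (0 : ℝ) ≤ d := by positivity
  have h7 : (0 : ℝ) ≤ h := by positivity
  nlinarith [mul_le_mul_of_nonneg_left h4 h7, mul_le_mul h4 (h4.trans h5) h6 (h6.trans h4)]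

theorem prod_range_one_sub_four_div_sq (N : ℕ) :
    ∏ i ∈ range N, ((1 : ℝ) - 4 / ((i : ℝ) + 5) ^ 2) =
      2 / 5 * (((N : ℝ) + 5) * (N + 6) / ((N + 3) * (N + 4))) := by
  induction N with
  | zero => norm_num
  | succ N ih =>
    rw [Finset.prod_range_succ, ih]
    push_cast
    field_simp
    ring

theorem two_fifths_le_prod (z : ℕ) :
    2 / 5 ≤ ∏ p ∈ splitPrimes z, ((1 : ℝ) - 4 / (p : ℝ) ^ 2) := by
  set f : ℕ → ℝ := fun p => 1 - 4 / (p : ℝ) ^ 2 with hf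
  set Q := (range z).image (· + 5) with hQ
  have hmem : ∀ p ∈ Q, 0 ≤ f p ∧ f p ≤ 1 := by
    intro p hp
    obtain ⟨i, -, rfl⟩ := Finset.mem_image.1 hp
    have h : (4 : ℝ) / ((i + 5 : ℕ) : ℝ) ^ 2 ≤ 1 := by
      rw [div_le_one (by positivity)]
      push_cast
      nlinarith [(Nat.cast_nonneg i : (0 : ℝ) ≤ i)]
    exact ⟨by rw [hf]; simp only; linarith, by rw [hf]; simp only; linarith [
      (by positivity : (0 : ℝ) ≤ 4 / ((i + 5 : ℕ) : ℝ) ^ 2)]⟩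
  have hsub : splitPrimes z ⊆ Q := by
    intro p hp
    have h5 := five_le_of_mem_splitPrimes hp
    have hz := (mem_splitPrimes.1 hp).1
    exact Finset.mem_image.2 ⟨p - 5, Finset.mem_range.2 (by omega), by omega⟩
  have h1 : 2 / 5 ≤ ∏ p ∈ Q, f p := by
    rw [hQ, Finset.prod_image fun a _ c _ h => Nat.add_right_cancel h]
    have h2 := prod_range_one_sub_four_div_sq z
    rw [hf]
    push_cast
    rw [h2]
    have h3 : (1 : ℝ) ≤ (z + 5) * (z + 6) / ((z + 3) * (z + 4)) := by
      rw [one_le_div (by positivity)]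
      nlinarith [(Nat.cast_nonneg z : (0 : ℝ) ≤ z)]
    linarith
  refine h1.trans ?_
  rw [← Finset.prod_sdiff hsub]
  refine mul_le_of_le_one_left (Finset.prod_nonneg fun p hp => (hmem p (hsub hp)).1) ?_
  exact Finset.prod_le_one (fun p hp => (hmem p (Finset.sdiff_subset hp)).1)
    fun p hp => (hmem p (Finset.sdiff_subset hp)).2

theorem two_fifths_le_prod_density (z : ℕ) :
    2 / 5 ≤ (∏ p ∈ splitPrimes z, (1 - normDensity p)) *
      (∏ p ∈ splitPrimes z, (1 + 1 / (p : ℝ))) ^ 2 := by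
  refine (two_fifths_le_prod z).trans ?_
  rw [← Finset.prod_pow, ← Finset.prod_mul_distrib]
  refine Finset.prod_le_prod (fun p hp => ?_) fun p hp => ?_
  · have h5 : (5 : ℝ) ≤ p := by exact_mod_cast five_le_of_mem_splitPrimes hp
    rw [sub_nonneg, div_le_one (by positivity)]
    nlinarith
  · have h5 : (5 : ℝ) ≤ p := by exact_mod_cast five_le_of_mem_splitPrimes hp
    have h1 := normDensity_prime_le (mem_splitPrimes.1 hp).2.1
    have h0 : (0 : ℝ) < p := by linarith
    set q : ℝ := 1 / p with hq
    have hq0 : 0 ≤ q := by positivity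
    have hq5 : q ≤ 1 / 5 := one_div_le_one_div_of_le (by norm_num) h5
    have h2 : (4 : ℝ) / p ^ 2 = 4 * q ^ 2 := by rw [hq]; field_simp
    have h3 : (2 : ℝ) / p = 2 * q := by rw [hq]; field_simp
    rw [h2]
    rw [h3] at h1
    calc 1 - 4 * q ^ 2 = (1 - 2 * q) * (1 + 2 * q) := by ring
      _ ≤ (1 - 2 * q) * (1 + q) ^ 2 := by
        refine mul_le_mul_of_nonneg_left ?_ (by linarith)
        nlinarith
      _ ≤ (1 - normDensity p) * (1 + q) ^ 2 := by gcongr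

theorem prod_one_add_inv_le (z : ℕ) : ∏ p ∈ splitPrimes z, (1 + 1 / (p : ℝ)) ≤ z + 1 := by
  have hsub : splitPrimes z ⊆ (range z).image (· + 1) := by
    intro p hp
    have h5 := five_le_of_mem_splitPrimes hp
    have hz := (mem_splitPrimes.1 hp).1
    exact Finset.mem_image.2 ⟨p - 1, Finset.mem_range.2 (by omega), by omega⟩
  have h1 : ∀ N : ℕ, ∏ i ∈ range N, (1 + 1 / ((i + 1 : ℕ) : ℝ)) = N + 1 := by
    intro N
    induction N with
    | zero => simp
    | succ N ih =>
      rw [Finset.prod_range_succ, ih]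
      push_cast
      field_simp
  rw [← h1 z, ← Finset.prod_image (f := fun p : ℕ => 1 + 1 / (p : ℝ))
    fun a _ c _ h => Nat.add_right_cancel h, ← Finset.prod_sdiff hsub]
  refine le_mul_of_one_le_left (Finset.prod_nonneg fun p _ => by positivity) ?_
  refine Finset.prod_const_one.symm.le.trans
    (Finset.prod_le_prod (fun _ _ => zero_le_one) fun p _ => ?_)
  linarith [(by positivity : (0 : ℝ) ≤ 1 / (p : ℝ))]

/-- Many lattice points of a progression have norm free of small split primes. -/
theorem exists_rough_pairs_bound :
    ∃ C : ℕ, 1 ≤ C ∧ ∀ n k h x y : ℕ, 0 < k → (∀ p : ℕ, p.Prime → p ∣ k → p % 4 = 3) →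
      (2 ^ 2 ^ n) ^ C ≤ h →
      (h : ℝ) ^ 2 / 4 * ∏ p ∈ splitPrimes (2 ^ 2 ^ n), (1 - normDensity p) ≤
        #((range h ×ˢ range h).filter fun r =>
          ∀ p ∈ splitPrimes (2 ^ 2 ^ n), ¬ p ∣ (x + k * r.1) ^ 2 + (y + k * r.2) ^ 2) := by
  obtain ⟨C, hC⟩ := exists_sieve_lower_bound
  refine ⟨2 * C + 10, by omega, fun n k h x y hk0 hk hzh => ?_⟩
  have h1 := hC n normDensity normDensity_nonneg normDensity_le_one
    (fun p hp => normDensity_prime_le (mem_splitPrimes.1 hp).2.1) (range h ×ˢ range h)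
    (fun p r => p ∣ (x + k * r.1) ^ 2 + (y + k * r.2) ^ 2) ((h : ℝ) ^ 2)
    (3 * h * ((2 ^ 2 ^ n) ^ C : ℕ)) (by positivity) (by positivity) ?_
  · have hW := prod_one_add_inv_le (2 ^ 2 ^ n)
    have hVW := two_fifths_le_prod_density (2 ^ 2 ^ n)
    have hn : ((n + 1 : ℕ) : ℝ) ≤ ((2 ^ 2 ^ n : ℕ) : ℝ) := by
      exact_mod_cast (Nat.lt_two_pow_self (n := n)).trans (Nat.lt_two_pow_self (n := 2 ^ n))
    have hz2 : (2 : ℝ) ≤ ((2 ^ 2 ^ n : ℕ) : ℝ) := by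
      exact_mod_cast Nat.le_self_pow (pow_pos two_pos n).ne' 2
    have hzh' : ((2 ^ 2 ^ n : ℕ) : ℝ) ^ (2 * C + 10) ≤ h := by exact_mod_cast hzh
    set z : ℕ := 2 ^ 2 ^ n
    set V := ∏ p ∈ splitPrimes z, (1 - normDensity p)
    set W := ∏ p ∈ splitPrimes z, (1 + 1 / (p : ℝ))
    have hV0 : 0 ≤ V := Finset.prod_nonneg fun p _ => sub_nonneg.2 (normDensity_le_one p)
    have hW0 : 0 ≤ W := Finset.prod_nonneg fun p _ => by positivity
    have hVz : 1 ≤ 10 * (z : ℝ) ^ 2 * V := by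
      have h2 : W ^ 2 ≤ 4 * (z : ℝ) ^ 2 := by nlinarith
      nlinarith [mul_le_mul_of_nonneg_left h2 hV0]
    have h128 : (120 : ℝ) ≤ (z : ℝ) ^ 7 := by
      calc (120 : ℝ) ≤ 2 ^ 7 := by norm_num
        _ ≤ _ := by gcongr
    have hkey : 12 * ((n : ℝ) + 1) * ((z : ℝ) ^ C) ^ 2 ≤ h * V := by
      push_cast at hn
      have hz0 : (0 : ℝ) ≤ z := by linarith
      calc 12 * ((n : ℝ) + 1) * ((z : ℝ) ^ C) ^ 2 ≤ 12 * z * ((z : ℝ) ^ C) ^ 2 := by gcongr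
        _ ≤ 12 * z * ((z : ℝ) ^ C) ^ 2 * (10 * (z : ℝ) ^ 2 * V) :=
          le_mul_of_one_le_right (by positivity) hVz
        _ = (120 * ((z : ℝ) ^ C) ^ 2 * z ^ 3) * V := by ring
        _ ≤ ((z : ℝ) ^ 7 * ((z : ℝ) ^ C) ^ 2 * z ^ 3) * V := by gcongr
        _ = (z : ℝ) ^ (2 * C + 10) * V := by ring
        _ ≤ h * V := by gcongr
    have hh0 : (0 : ℝ) ≤ h := by positivity
    have h3 := mul_le_mul_of_nonneg_left hkey hh0
    refine le_trans ?_ (h1.trans (le_of_eq (by congr!)))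
    push_cast
    nlinarith
  · intro u hu hprod
    refine le_trans (le_of_eq ?_) (abs_card_forall_dvd_sub_le (k := k) (u := u) (fun p hp => ?_) h x y
      _ hprod ?_)
    · congr!
    · obtain ⟨-, hp1, hp2⟩ := mem_splitPrimes.1 (hu hp)
      refine ⟨hp1, (hp1.coprime_iff_not_dvd.2 fun hd => ?_).symm⟩
      have := hk p hp1 hd
      omega
    · exact (Nat.pow_le_pow_right (by positivity) (by omega)).trans hzh

/-- The pairs with `s (x² + y²)` in the progression `m (mod k)`, in a dyadic range, and with
`x² + y²` free of the split primes up to `z`. -/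
def goodPairs (M k m s z : ℕ) : Finset (ℕ × ℕ) :=
  (range (2 * M * k + m) ×ˢ range (2 * M * k + m)).filter fun r =>
    (M * k + m ≤ s * (r.1 ^ 2 + r.2 ^ 2) ∧ s * (r.1 ^ 2 + r.2 ^ 2) < 2 * M * k + m ∧
      s * (r.1 ^ 2 + r.2 ^ 2) ≡ m [MOD k]) ∧
    ∀ p ∈ splitPrimes z, ¬ p ∣ r.1 ^ 2 + r.2 ^ 2

theorem exists_box {s k B A : ℕ} (hs : 0 < s) (hk : 0 < k) (hB : 0 < B)
    (hA : s * (60 * k * B) ^ 2 ≤ A) :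
    ∃ X h : ℕ, B ≤ h ∧ A ≤ s * X ^ 2 ∧ A ≤ 1600 * s * k ^ 2 * h ^ 2 ∧
      ∀ x y, x < X + k * (h + 2) → y < k * (h + 2) → 3 * (s * (x ^ 2 + y ^ 2)) < 4 * A := by
  set r := Nat.sqrt (A / s) with hr
  have hr1 : 60 * k * B ≤ r := by
    rw [hr, Nat.le_sqrt', Nat.le_div_iff_mul_le hs]
    linarith
  have hr2 : s * r ^ 2 ≤ A :=
    (Nat.mul_le_mul_left s (Nat.sqrt_le' _)).trans (Nat.mul_div_le A s)
  have hr3 : A ≤ s * (r + 1) ^ 2 := by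
    refine (Nat.lt_mul_div_succ A hs).le.trans (Nat.mul_le_mul_left s ?_)
    exact Nat.lt_succ_sqrt' _
  have hkB : k ≤ k * B := Nat.le_mul_of_pos_right k hB
  set h := r / (20 * k) with hh
  have hh1 : 20 * k * h ≤ r := Nat.mul_div_le _ _
  have hh2 : r + 1 ≤ 20 * k * (h + 1) := Nat.lt_mul_div_succ r (by positivity)
  have hh3 : B ≤ h := by
    rw [hh, Nat.le_div_iff_mul_le (by positivity)]
    linarith
  have hr60 : 60 * k ≤ r := by linarith
  refine ⟨r + 1, h, hh3, hr3, ?_, fun x y hx hy => ?_⟩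
  · have h1 : r + 1 ≤ 40 * k * h := by
      have : k ≤ k * h := Nat.le_mul_of_pos_right k (hB.trans_le hh3)
      linarith
    calc A ≤ s * (r + 1) ^ 2 := hr3
      _ ≤ s * (40 * k * h) ^ 2 := by gcongr
      _ = _ := by ring
  · have hx1 : 10 * x ≤ 11 * r := by
      rw [mul_add] at hx; linarith
    have hy1 : 10 * y ≤ r := by
      rw [mul_add] at hy; linarith
    have hx2 : (10 * x) ^ 2 ≤ (11 * r) ^ 2 := Nat.pow_le_pow_left hx1 2
    have hy2 : (10 * y) ^ 2 ≤ r ^ 2 := Nat.pow_le_pow_left hy1 2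
    have h1 : 100 * (x ^ 2 + y ^ 2) ≤ 122 * r ^ 2 := by linarith
    have h2 := Nat.mul_le_mul_left s h1
    have h3 : 0 < s * r ^ 2 := by
      have : 0 < r := by omega
      positivity
    linarith

theorem exists_card_goodPairs_ge :
    ∃ C : ℕ, ∀ n M k m s : ℕ, 0 < k → (∀ p : ℕ, p.Prime → p ∣ k → p % 4 = 3) →
      (∀ p : ℕ, p.Prime → p ∣ m → p % 4 = 1) → (∀ p : ℕ, p.Prime → p ∣ s → p % 4 = 1) →
      0 < s → k ≤ (2 ^ 2 ^ n) ^ 2 → s ≤ (2 ^ 2 ^ n) ^ 4 → m ≤ 2 * M * k →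
      (2 ^ 2 ^ n) ^ C ≤ M →
      (M : ℝ) / (6400 * s) * ∏ p ∈ splitPrimes (2 ^ 2 ^ n), (1 - normDensity p) ≤
        #(goodPairs M k m s (2 ^ 2 ^ n)) := by
  obtain ⟨C, hC1, hC⟩ := exists_rough_pairs_bound
  refine ⟨2 * C + 18, fun n M k m s hk0 hk hm hs hs0 hkz hsz hmM hM => ?_⟩
  have hz2 : 2 ≤ 2 ^ 2 ^ n := Nat.le_self_pow (pow_pos two_pos n).ne' 2
  set z := 2 ^ 2 ^ n with hz
  have hA : s * (60 * k * z ^ C) ^ 2 ≤ M * k + m := by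
    calc s * (60 * k * z ^ C) ^ 2 ≤ z ^ 4 * (60 * k * z ^ C) ^ 2 := by gcongr
      _ = 3600 * k * (z ^ 4 * (z ^ C) ^ 2) * k := by ring
      _ ≤ z ^ 12 * z ^ 2 * (z ^ 4 * (z ^ C) ^ 2) * k := by
        have : 3600 ≤ z ^ 12 := le_trans (by norm_num) (Nat.pow_le_pow_left hz2 12)
        gcongr
      _ = z ^ (2 * C + 18) * k := by ring
      _ ≤ M * k := by gcongr
      _ ≤ _ := Nat.le_add_right _ _
  obtain ⟨X, h, hBh, hX, hAh, hbox⟩ := exists_box hs0 hk0 (by positivity) hA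
  set V := ∏ p ∈ splitPrimes z, (1 - normDensity p)
  have hV0 : 0 ≤ V := Finset.prod_nonneg fun p _ => sub_nonneg.2 (normDensity_le_one p)
  set Q := (range k ×ˢ range k).filter fun r => s * (r.1 ^ 2 + r.2 ^ 2) ≡ m [MOD k] with hQ
  have hQk : k ≤ #Q := le_card_residue_pairs hk0 hk hm hs
  set G := goodPairs M k m s z with hG
  have hfiber : ∀ q ∈ Q, (h : ℝ) ^ 2 / 4 * V ≤ #(G.filter fun r => (r.1 % k, r.2 % k) = q) := by
    intro q hq
    obtain ⟨hq1, hq2⟩ := Finset.mem_filter.1 hq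
    obtain ⟨hqx, hqy⟩ := Finset.mem_product.1 hq1
    rw [Finset.mem_range] at hqx hqy
    set x := q.1 + k * (X / k + 1) with hx
    have hxX : X ≤ x := (Nat.lt_mul_div_succ X hk0).le.trans (Nat.le_add_left _ _)
    have hxX2 : x < X + 2 * k := by
      have := Nat.mul_div_le X k
      rw [hx, mul_add]
      omega
    refine (hC n k h x q.2 hk0 hk hBh).trans ?_
    rw [Nat.cast_le]
    refine Finset.card_le_card_of_injOn (fun r => (x + k * r.1, q.2 + k * r.2)) ?_ ?_
    · intro r hr
      simp only [Finset.coe_filter, Set.mem_ofPred_eq, Finset.mem_product,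
        Finset.mem_range] at hr
      obtain ⟨⟨hr1, hr2⟩, hrp⟩ := hr
      have hmod1 : x + k * r.1 ≡ q.1 [MOD k] := by
        rw [hx, add_assoc, ← mul_add]
        simp [Nat.ModEq]
      have hmod2 : q.2 + k * r.2 ≡ q.2 [MOD k] := by simp [Nat.ModEq]
      have hlt : 3 * (s * ((x + k * r.1) ^ 2 + (q.2 + k * r.2) ^ 2)) < 4 * (M * k + m) := by
        have e1 : k * (r.1 + 1) ≤ k * h := Nat.mul_le_mul_left k hr1
        have e2 : k * (r.2 + 1) ≤ k * h := Nat.mul_le_mul_left k hr2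
        rw [mul_add] at e1 e2
        refine hbox _ _ ?_ ?_ <;> rw [mul_add] <;> omega
      set l := s * ((x + k * r.1) ^ 2 + (q.2 + k * r.2) ^ 2) with hl
      have hl2 : l < 2 * M * k + m := by
        have : 2 * M * k = 2 * (M * k) := by ring
        omega
      have hle : (x + k * r.1) ^ 2 + (q.2 + k * r.2) ^ 2 ≤ l := Nat.le_mul_of_pos_left _ hs0
      have hle1 := Nat.le_self_pow two_ne_zero (x + k * r.1)
      have hle2 := Nat.le_self_pow two_ne_zero (q.2 + k * r.2)
      rw [Finset.mem_coe, Finset.mem_filter]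
      refine ⟨Finset.mem_filter.2 ⟨Finset.mem_product.2 ⟨Finset.mem_range.2 ?_,
        Finset.mem_range.2 ?_⟩, ⟨?_, hl2, ?_⟩, hrp⟩, ?_⟩
      · simp only; omega
      · simp only; omega
      · refine hX.trans (Nat.mul_le_mul_left s ?_)
        exact (Nat.pow_le_pow_left (hxX.trans (Nat.le_add_right _ _)) 2).trans
          (Nat.le_add_right _ _)
      · exact (((hmod1.pow 2).add (hmod2.pow 2)).mul_left s).trans hq2
      · exact Prod.ext (Eq.trans hmod1 (Nat.mod_eq_of_lt hqx)) (Eq.trans hmod2 (Nat.mod_eq_of_lt hqy))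
    · intro r _ r' _ hrr
      simp only [Prod.mk.injEq, add_right_inj] at hrr
      exact Prod.ext (Nat.eq_of_mul_eq_mul_left hk0 hrr.1) (Nat.eq_of_mul_eq_mul_left hk0 hrr.2)
  have hsum : (k : ℝ) * ((h : ℝ) ^ 2 / 4 * V) ≤ #G := by
    calc (k : ℝ) * ((h : ℝ) ^ 2 / 4 * V) ≤ #Q * ((h : ℝ) ^ 2 / 4 * V) := by
          gcongr
      _ = ∑ q ∈ Q, (h : ℝ) ^ 2 / 4 * V := by rw [Finset.sum_const, nsmul_eq_mul]
      _ ≤ ∑ q ∈ Q, (#(G.filter fun r => (r.1 % k, r.2 % k) = q) : ℝ) := Finset.sum_le_sum hfiber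
      _ = #(G.filter fun r => (r.1 % k, r.2 % k) ∈ Q) := by
          rw [← Nat.cast_sum, Finset.sum_card_fiberwise_eq_card_filter]
      _ ≤ #G := by
          rw [Nat.cast_le]
          exact Finset.card_filter_le _ _
  refine le_trans ?_ hsum
  have hk0' : (0 : ℝ) < k := by exact_mod_cast hk0
  have hs0' : (0 : ℝ) < s := by exact_mod_cast hs0
  have h1 : (M : ℝ) * k ≤ 1600 * s * k ^ 2 * h ^ 2 := by
    exact_mod_cast (Nat.le_add_right _ _).trans hAh
  have h2 : (M : ℝ) / (6400 * s) ≤ k * (h ^ 2 / 4) := by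
    rw [div_le_iff₀ (by positivity)]
    refine le_of_mul_le_mul_right ?_ hk0'
    linarith
  calc _ ≤ (k * ((h : ℝ) ^ 2 / 4)) * V := by gcongr
    _ = _ := by ring

theorem card_sq_add_sq_eq_le (T n j : ℕ) (hn : 0 < n) (hnT : n < T ^ j)
    (hp : ∀ p : ℕ, p.Prime → p % 4 = 1 → p ∣ n → T ≤ p) (Z : Finset (ℕ × ℕ))
    (hZ : ∀ r ∈ Z, r.1 ^ 2 + r.2 ^ 2 = n) : #Z ≤ 4 * 2 ^ j := by
  set e : ℕ × ℕ → GaussianInt := fun r => ⟨r.1, r.2⟩ with he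
  have hinj : Set.InjOn e Z := by
    intro r _ r' _ h
    have h1 := congrArg Zsqrtd.re h
    have h2 := congrArg Zsqrtd.im h
    simp only [he, Nat.cast_inj] at h1 h2
    exact Prod.ext h1 h2
  rw [← Finset.card_image_of_injOn hinj]
  refine GaussianInt.card_norm_eq_le T n j _ hn hnT hp fun z hz => ?_
  obtain ⟨r, hr, rfl⟩ := Finset.mem_image.1 hz
  rw [GaussianInt.norm_eq_sq_add_sq]
  simp only [he]
  exact_mod_cast hZ r hr

theorem mod_four_eq_one_of_dvd_prod {z : ℕ} {u : Finset ℕ} (hu : u ⊆ splitPrimes z) {p : ℕ}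
    (hp : p.Prime) (hpu : p ∣ ∏ q ∈ u, q) : p ∈ u ∧ p % 4 = 1 := by
  obtain ⟨q, hq, hpq⟩ := (hp.prime.dvd_finsetProd_iff _).1 hpu
  obtain ⟨-, hq1, hq2⟩ := mem_splitPrimes.1 (hu hq)
  rw [(Nat.prime_dvd_prime_iff_eq hp hq1).1 hpq]
  exact ⟨hq, hq2⟩

/-- The pairs attached to all the multipliers `∏ p ∈ u, p` represent each sum of two squares a
bounded number of times. -/
theorem sum_card_goodPairs_le {M k m z j : ℕ} (hpos : 0 < M * k + m)
    (hj : 2 * M * k + m ≤ z ^ j) (U : Finset (Finset ℕ)) (hU : ∀ u ∈ U, u ⊆ splitPrimes z) :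
    ∑ u ∈ U, #(goodPairs M k m (∏ p ∈ u, p) z) ≤
      4 * 2 ^ j * ∑ l ∈ (Finset.Ico (M * k + m) (2 * M * k + m)).filter
        (fun l => l % k = m % k), b l := by
  have hb : ∑ l ∈ (Finset.Ico (M * k + m) (2 * M * k + m)).filter
      (fun l => l % k = m % k), b l =
      #(((Finset.Ico (M * k + m) (2 * M * k + m)).filter
        (fun l => l % k = m % k)).filter IsSumTwoSquares) := by
    simp only [b, Finset.card_filter _ _]
  rw [hb, ← Finset.card_sigma]
  set f : (Σ _ : Finset ℕ, ℕ × ℕ) → ℕ :=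
    fun a => (∏ p ∈ a.1, p) * (a.2.1 ^ 2 + a.2.2 ^ 2) with hf
  refine Finset.card_le_mul_card_image_of_maps_to (f := f) ?_ _ ?_
  · rintro ⟨u, x, y⟩ ha
    obtain ⟨hu, hxy⟩ := Finset.mem_sigma.1 ha
    obtain ⟨-, ⟨h1, h2, h3⟩, -⟩ := Finset.mem_filter.1 hxy
    refine Finset.mem_filter.2 ⟨Finset.mem_filter.2 ⟨Finset.mem_Ico.2 ⟨h1, h2⟩, h3⟩, ?_⟩
    obtain ⟨e, g, heg⟩ := exists_eq_sq_add_sq (n := ∏ p ∈ u, p)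
      fun p hp hpu => (mod_four_eq_one_of_dvd_prod (hU u hu) hp hpu).2
    refine ⟨e * x - g * y, e * y + g * x, ?_⟩
    simp only [hf, heg]
    push_cast
    ring
  · intro l hl
    obtain ⟨hl1, -⟩ := Finset.mem_filter.1 hl
    have hlI := Finset.mem_Ico.1 (Finset.mem_filter.1 hl1).1
    set u₀ := (splitPrimes z).filter (· ∣ l) with hu₀
    set Z := ((U.sigma fun u => goodPairs M k m (∏ p ∈ u, p) z).filter fun a => f a = l) with hZ
    have key : ∀ a ∈ Z, a.1 = u₀ ∧ (∏ p ∈ u₀, p) * (a.2.1 ^ 2 + a.2.2 ^ 2) = l ∧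
        ∀ p ∈ splitPrimes z, ¬ p ∣ a.2.1 ^ 2 + a.2.2 ^ 2 := by
      rintro ⟨u, x, y⟩ ha
      obtain ⟨ha1, ha2⟩ := Finset.mem_filter.1 ha
      obtain ⟨hu, hxy⟩ := Finset.mem_sigma.1 ha1
      obtain ⟨-, -, hrough⟩ := Finset.mem_filter.1 hxy
      have huu : u = u₀ := by
        ext p
        rw [hu₀, Finset.mem_filter, ← ha2]
        constructor
        · exact fun hp => ⟨hU u hu hp, (Finset.dvd_prod_of_mem _ hp).mul_right _⟩
        · rintro ⟨hp1, hp2⟩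
          have hpp := (mem_splitPrimes.1 hp1).2.1
          rcases hpp.dvd_mul.1 hp2 with h | h
          · exact (mod_four_eq_one_of_dvd_prod (hU u hu) hpp h).1
          · exact absurd h (hrough p hp1)
      exact ⟨huu, by rw [← huu]; exact ha2, hrough⟩
    rcases Z.eq_empty_or_nonempty with hZe | ⟨a₀, ha₀⟩
    · rw [hZe]; simp
    obtain ⟨-, h1, h2⟩ := key a₀ ha₀
    set N := a₀.2.1 ^ 2 + a₀.2.2 ^ 2 with hN
    have hs0 : 0 < ∏ p ∈ u₀, p := Finset.prod_pos fun p hp =>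
      (mem_splitPrimes.1 (Finset.mem_filter.1 hp).1).2.1.pos
    have hN0 : 0 < N := by
      refine Nat.pos_of_ne_zero fun h => ?_
      rw [h, mul_zero] at h1
      omega
    have hNl : N ≤ l := h1 ▸ Nat.le_mul_of_pos_left _ hs0
    have hinj : Set.InjOn (fun a : (Σ _ : Finset ℕ, ℕ × ℕ) => a.2) Z := by
      intro a ha a' ha' h
      exact Sigma.ext ((key a ha).1.trans (key a' ha').1.symm) (heq_of_eq h)
    rw [← Finset.card_image_of_injOn hinj]
    refine card_sq_add_sq_eq_le z N j hN0 (by omega) ?_ _ ?_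
    · intro p hp hp4 hpN
      by_contra! hlt
      exact h2 p (mem_splitPrimes.2 ⟨hlt.le, hp, hp4⟩) hpN
    · intro r hr
      obtain ⟨a, ha, rfl⟩ := Finset.mem_image.1 hr
      exact Nat.eq_of_mul_eq_mul_left hs0 ((key a ha).2.1.trans h1.symm)

/-- A doubly exponential scale `z` with `z ^ E ≤ M < z ^ (2 * E)`. -/
theorem exists_scale {E M : ℕ} (hE : 0 < E) (hM : 2 ^ E ≤ M) :
    ∃ n : ℕ, (2 ^ 2 ^ n) ^ E ≤ M ∧ M < (2 ^ 2 ^ n) ^ (2 * E) := by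
  have hex : ∃ n : ℕ, M < (2 ^ 2 ^ n) ^ E := by
    refine ⟨M, (Nat.lt_two_pow_self.trans Nat.lt_two_pow_self).trans_le ?_⟩
    exact Nat.le_self_pow hE.ne' _
  obtain ⟨n, hn⟩ : ∃ n, Nat.find hex = n + 1 := by
    refine Nat.exists_eq_succ_of_ne_zero fun h => ?_
    have h1 := Nat.find_spec hex
    rw [h, pow_zero, pow_one] at h1
    omega
  refine ⟨n, not_lt.1 (Nat.find_min hex (by omega)), ?_⟩
  have h1 := Nat.find_spec hex
  rwa [hn, pow_succ 2 n, pow_mul, ← pow_mul] at h1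

theorem inv_sqrt_le_mul {V W T L : ℝ} (hV : 0 ≤ V) (hW : 0 < W) (hL : 1 ≤ L)
    (hVW : 2 / 5 ≤ V * W ^ 2) (hWT : W / 2 ≤ T) (hT : T ^ 2 ≤ 40 * L) :
    1 / (70 * Real.sqrt L) ≤ V * T := by
  have hsL : 0 < Real.sqrt L := Real.sqrt_pos.2 (by linarith)
  have hT0 : 0 < T := by linarith
  have hTL : T ≤ 7 * Real.sqrt L := by
    refine le_of_sq_le_sq ?_ (by positivity)
    rw [mul_pow, Real.sq_sqrt (by linarith)]
    linarith
  have h1 : W ^ 2 ≤ (2 * T) ^ 2 := pow_le_pow_left₀ hW.le (by linarith) 2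
  have h2 := mul_le_mul_of_nonneg_left h1 hV
  have h3 := mul_le_mul_of_nonneg_left hTL (mul_nonneg hV hT0.le)
  rw [div_le_iff₀ (by positivity)]
  linarith

/-- With `K = (log M)^{5/8}`: there is `c > 0` such that for all large `M`,
all `m ≤ M·K` with all prime divisors `≡ 1 (mod 4)`, and all `K/2 ≤ k ≤ K` with all
prime divisors `≡ 3 (mod 4)`, one has
`Σ_{Mk+m ≤ l < 2Mk+m, l ≡ m (k)} b(l) ≥ c·M/√(log M)`. -/
theorem sum_over_progression_lower_bound :
    ∃ c : ℝ, 0 < c ∧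
      ∀ᶠ M : ℕ in atTop, ∀ m k : ℕ,
        (m : ℝ) ≤ M * Real.log M ^ ((5:ℝ)/8) →
        (∀ p : ℕ, p.Prime → p ∣ m → p % 4 = 1) →
        Real.log M ^ ((5:ℝ)/8) / 2 ≤ (k : ℝ) →
        (k : ℝ) ≤ Real.log M ^ ((5:ℝ)/8) →
        (∀ p : ℕ, p.Prime → p ∣ k → p % 4 = 3) →
        c * M / Real.sqrt (Real.log M) ≤
          ∑ l ∈ (Finset.Ico (M * k + m) (2 * M * k + m)).filter
              (fun l => l % k = m % k), (b l : ℝ) := by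
  obtain ⟨C, hC⟩ := exists_card_goodPairs_ge
  set E := C + 1 with hE
  have hlog : ∀ᶠ M : ℕ in atTop, (1 : ℝ) ≤ Real.log M :=
    (Real.tendsto_log_atTop.comp tendsto_natCast_atTop_atTop).eventually_ge_atTop 1
  refine ⟨1 / (1792000 * 4 * 2 ^ (2 * E + 4)), by positivity, ?_⟩
  filter_upwards [hlog, eventually_ge_atTop ((2 * E) ^ (2 * E)), eventually_ge_atTop (2 ^ E)]
    with M hL hME hM2 m k hmK hm hkK hk1 hk
  set L := Real.log M with hLdef
  set K := L ^ ((5 : ℝ) / 8) with hK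
  have hK1 : 1 ≤ K := Real.one_le_rpow hL (by norm_num)
  have hKL : K ≤ L := Real.rpow_le_self_of_one_le hL (by norm_num)
  have hk0 : 0 < k := by
    have : (0 : ℝ) < k := by linarith
    exact_mod_cast this
  have hM0 : 0 < M := (by positivity : 0 < 2 ^ E).trans_le hM2
  have hmM : m ≤ 2 * M * k := by
    have h0 : (0 : ℝ) ≤ M := by positivity
    have h1 : (m : ℝ) ≤ 2 * M * k := by nlinarith
    exact_mod_cast h1
  obtain ⟨n, hzM, hMz⟩ := exists_scale (E := E) (by omega) hM2
  have hz2 : 2 ≤ 2 ^ 2 ^ n := Nat.le_self_pow (pow_pos two_pos n).ne' 2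
  have hC' := hC n M k m
  have hhalf := half_prod_le_sum_inv_prod (splitPrimes (2 ^ 2 ^ n)) (2 ^ 2 ^ n) hz2
    fun p hp => ⟨(mem_splitPrimes.1 hp).2.1, (mem_splitPrimes.1 hp).1⟩
  have hsq := sq_sum_inv_prod_le (splitPrimes (2 ^ 2 ^ n))
    (fun p hp => (mem_splitPrimes.1 hp).2) ((2 ^ 2 ^ n) ^ 4)
  have hVW := two_fifths_le_prod_density (2 ^ 2 ^ n)
  set z := 2 ^ 2 ^ n with hz
  set V := ∏ p ∈ splitPrimes z, (1 - normDensity p) with hV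
  set W := ∏ p ∈ splitPrimes z, (1 + 1 / (p : ℝ)) with hW
  set U := (splitPrimes z).powerset.filter fun u => ∏ p ∈ u, p ≤ z ^ 4 with hU
  set T := ∑ u ∈ U, 1 / ((∏ p ∈ u, p : ℕ) : ℝ) with hT
  have hV0 : 0 ≤ V := Finset.prod_nonneg fun p _ => sub_nonneg.2 (normDensity_le_one p)
  have hW0 : 0 < W := Finset.prod_pos fun p _ => by positivity
  have hT0 : 0 < T := by linarith
  have hzL : (2 : ℝ) ≤ z := by exact_mod_cast hz2
  have hlogz : 0 ≤ Real.log z := Real.log_nonneg (by linarith)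
  have hElog : Real.log z ≤ L := by
    rw [hLdef]
    refine Real.log_le_log (by linarith) ?_
    exact_mod_cast (Nat.le_self_pow (by omega) z).trans hzM
  have hkz : k ≤ z ^ 2 := by
    have h1 : L ≤ 2 * E * Real.log z := by
      have h2 : (M : ℝ) ≤ (z : ℝ) ^ (2 * E) := by exact_mod_cast hMz.le
      have h3 := Real.log_le_log (by exact_mod_cast hM0) h2
      rw [Real.log_pow] at h3
      exact_mod_cast h3
    have h4 : 2 * E < z := lt_of_pow_lt_pow_left₀ (2 * E) (Nat.zero_le _) (hME.trans_lt hMz)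
    have h5 : (2 * E : ℝ) ≤ z := by exact_mod_cast h4.le
    have h6 : Real.log z ≤ z := Real.log_le_self (by linarith)
    have h7 : (k : ℝ) ≤ (z : ℝ) ^ 2 := by
      calc (k : ℝ) ≤ L := hk1.trans hKL
        _ ≤ 2 * E * Real.log z := h1
        _ ≤ z * z := by gcongr
        _ = _ := by ring
    exact_mod_cast h7
  have hj : 2 * M * k + m ≤ z ^ (2 * E + 4) := by
    calc 2 * M * k + m ≤ 4 * (M * k) := by linarith
      _ ≤ z ^ 2 * (z ^ (2 * E) * z ^ 2) := by
        have h4 : 4 ≤ z ^ 2 := Nat.pow_le_pow_left hz2 2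
        have := hMz.le
        gcongr
      _ = _ := by ring
  have hupper := sum_card_goodPairs_le (M := M) (k := k) (m := m) (z := z)
    (by positivity) hj U fun u hu => Finset.mem_powerset.1 (Finset.mem_filter.1 hu).1
  set S := ∑ l ∈ (Finset.Ico (M * k + m) (2 * M * k + m)).filter
    (fun l => l % k = m % k), b l with hS
  have hlower : (M : ℝ) / 6400 * V * T ≤ ((∑ u ∈ U, #(goodPairs M k m (∏ p ∈ u, p) z) : ℕ) : ℝ) := by
    rw [hT, Finset.mul_sum, Nat.cast_sum]
    refine Finset.sum_le_sum fun u hu => ?_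
    obtain ⟨hu1, hu2⟩ := Finset.mem_filter.1 hu
    have hus := Finset.mem_powerset.1 hu1
    refine le_trans (le_of_eq ?_) (hC' (∏ p ∈ u, p) hk0 hk hm
      (fun p hp hpu => (mod_four_eq_one_of_dvd_prod hus hp hpu).2)
      (Finset.prod_pos fun p hp => (mem_splitPrimes.1 (hus hp)).2.1.pos) hkz hu2 hmM
      ((Nat.pow_le_pow_right (by positivity) (by omega)).trans hzM))
    rw [one_div, div_mul_eq_div_div]
    ring
  have hT2 : T ^ 2 ≤ 40 * L := by
    refine hsq.trans ?_
    push_cast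
    rw [Real.log_pow]
    push_cast
    linarith
  have hsL : 0 < Real.sqrt L := Real.sqrt_pos.2 (by linarith)
  have hVTL := inv_sqrt_le_mul hV0 hW0 hL hVW hhalf hT2
  have hfinal : (M : ℝ) / 6400 * (1 / (70 * Real.sqrt L)) ≤ 4 * 2 ^ (2 * E + 4) * (S : ℝ) := by
    calc (M : ℝ) / 6400 * (1 / (70 * Real.sqrt L)) ≤ (M : ℝ) / 6400 * (V * T) := by gcongr
      _ = (M : ℝ) / 6400 * V * T := by ring
      _ ≤ _ := hlower
      _ ≤ ((4 * 2 ^ (2 * E + 4) * S : ℕ) : ℝ) := Nat.cast_le.2 hupper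
      _ = _ := by push_cast; ring
  rw [← Nat.cast_sum, ← hS]
  have hP : (0 : ℝ) < 2 ^ (2 * E + 4) := by positivity
  rw [div_le_iff₀ hsL, div_mul_eq_mul_div, one_mul, div_le_iff₀ (by positivity)]
  rw [mul_one_div, div_le_iff₀ (by positivity)] at hfinal
  have hMr : (0 : ℝ) ≤ M := by positivity
  have hSr : (0 : ℝ) ≤ S * Real.sqrt L * 2 ^ (2 * E + 4) := by positivity
  linarith
end
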